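/- arXiv:math/0304192 — 3 statements merged into one kernel-verified Lean document; each statement's English description precedes it below -/
import Mathlib

section
/- Let K be a field of characteristic not 2 and n >= 4. Consider indeterminates D_{{i,j}} for 2-element subsets of {1,...,n}, and for 3 <= r <= n-1 let I be the ideal generated by all r-by-r minors of the (n-1)x(n-1) matrix with (i,j)-entry D_{{i,j}} - D_{{i,n}} - D_{{j,n}} (with D_{{i,i}} := 0). If phi is a permutation of the indeterminates D_{{i,j}} (i.e., of the 2-element subsets of {1,...,n}) whose induced algebra automorphism maps I to itself, then there exists a permutation pi in S_n such that phi(D_{{i,j}}) = D_{{pi(i),pi(j)}} for all i,j. -/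
/-- The indeterminate `D_{{i,j}}` for a pair of distinct indices. -/
noncomputable def Dvar {K : Type*} [Field K] {n : ℕ} (i j : Fin n) (h : i ≠ j) :
    MvPolynomial {p : Sym2 (Fin n) // ¬ p.IsDiag} K :=
  MvPolynomial.X ⟨s(i, j), by simpa [Sym2.mk_isDiag_iff] using h⟩

/-- The `(n-1) × (n-1)` matrix with entries `D_{{i,j}} - D_{{i,n}} - D_{{j,n}}`
(indices `1,…,n-1`, with `D_{{i,i}} := 0`). -/
noncomputable def Dmatrix (K : Type*) [Field K] (n : ℕ) :
    Matrix (Fin n) (Fin n) (MvPolynomial {p : Sym2 (Fin (n + 1)) // ¬ p.IsDiag} K) :=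
  Matrix.of fun i j =>
    (if h : i = j then 0 else
      Dvar i.castSucc j.castSucc (by simpa [Fin.ext_iff] using fun hc => h (Fin.ext hc)))
    - Dvar i.castSucc (Fin.last n) (Fin.castSucc_lt_last i).ne
    - Dvar j.castSucc (Fin.last n) (Fin.castSucc_lt_last j).ne

namespace Stmt15

open MvPolynomial

abbrev E (n : ℕ) := {p : Sym2 (Fin (n + 1)) // ¬ p.IsDiag}

def mkE {n : ℕ} (i j : Fin (n + 1)) (h : i ≠ j) : E n :=
  ⟨s(i, j), by simpa [Sym2.mk_isDiag_iff] using h⟩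

/-- distance function with zero diagonal -/
noncomputable def Dg {R : Type*} [Zero R] {n : ℕ} (g : E n → R) (i j : Fin (n + 1)) : R :=
  if h : i = j then 0 else g (mkE i j h)

lemma Dg_self {R : Type*} [Zero R] {n : ℕ} (g : E n → R) (i : Fin (n + 1)) : Dg g i i = 0 := by
  simp [Dg]

lemma mkE_comm {n : ℕ} (i j : Fin (n + 1)) (h : i ≠ j) : mkE i j h = mkE j i h.symm := by
  simp [mkE, Sym2.eq_swap]

lemma Dg_comm {R : Type*} [Zero R] {n : ℕ} (g : E n → R) (i j : Fin (n + 1)) :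
    Dg g i j = Dg g j i := by
  unfold Dg
  by_cases h : i = j
  · simp [h]
  · rw [dif_neg h, dif_neg (fun h' => h h'.symm), mkE_comm]

lemma Dg_map {R S F : Type*} [Zero R] [Zero S] [FunLike F R S] [ZeroHomClass F R S] {n : ℕ}
    (f : F) (g : E n → R) (i j : Fin (n + 1)) :
    f (Dg g i j) = Dg (fun e => f (g e)) i j := by
  unfold Dg
  split_ifs <;> simp

/-- Gram matrix with base `b` -/
noncomputable def GB {R : Type*} [Ring R] {n : ℕ} {ι : Type*} (g : E n → R) (b : Fin (n + 1))
    (rows cols : ι → Fin (n + 1)) : Matrix ι ι R :=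
  Matrix.of fun k l => Dg g (rows k) (cols l) - Dg g (rows k) b - Dg g (cols l) b

lemma Dmatrix_eq (K : Type*) [Field K] (n : ℕ) :
    Dmatrix K n = GB (fun e => (X e : MvPolynomial (E n) K)) (Fin.last n)
      Fin.castSucc Fin.castSucc := by
  ext1 i j
  have hi : i.castSucc ≠ Fin.last n := (Fin.castSucc_lt_last i).ne
  have hj : j.castSucc ≠ Fin.last n := (Fin.castSucc_lt_last j).ne
  simp only [Dmatrix, GB, Matrix.of_apply, Dg, dif_neg hi, dif_neg hj]
  by_cases h : i = j
  · subst h; simp [Dvar, mkE]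
  · have h' : i.castSucc ≠ j.castSucc := by simpa using h
    simp only [dif_neg h, dif_neg h']
    simp [Dvar, mkE]

/-- weight bound -/
def WB {σ K : Type*} [CommSemiring K] (w : σ → ℕ) (k : ℕ) (q : MvPolynomial σ K) : Prop :=
  ∀ y, coeff y q ≠ 0 → Finsupp.weight w y ≤ k

section WB
variable {σ K : Type*} [CommRing K] (w : σ → ℕ)

lemma WB.mono {k l : ℕ} {q : MvPolynomial σ K} (h : WB w k q) (hkl : k ≤ l) : WB w l q :=
  fun y hy => (h y hy).trans hkl

lemma WB.zero (k : ℕ) : WB w k (0 : MvPolynomial σ K) := fun y hy => by simp at hy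

lemma WB.const (k : ℕ) (c : K) : WB w k (C c : MvPolynomial σ K) := fun y hy => by
  classical
  rw [coeff_C] at hy
  have : (0 : σ →₀ ℕ) = y := by by_contra h; simp [h] at hy
  simp [← this]

lemma WB.one (k : ℕ) : WB w k (1 : MvPolynomial σ K) := by
  simpa using WB.const w k (1 : K)

lemma WB.add {k : ℕ} {p q : MvPolynomial σ K} (hp : WB w k p) (hq : WB w k q) :
    WB w k (p + q) := fun y hy => by
  by_cases h : coeff y p = 0
  · exact hq y (by simpa [h] using hy)
  · exact hp y h

lemma WB.neg {k : ℕ} {p : MvPolynomial σ K} (hp : WB w k p) :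
    WB w k (-p) := fun y hy => hp y (by simpa using hy)

lemma WB.sub {k : ℕ} {p q : MvPolynomial σ K} (hp : WB w k p) (hq : WB w k q) :
    WB w k (p - q) := by
  rw [sub_eq_add_neg]; exact WB.add w hp (WB.neg w hq)

lemma WB.mul {k l : ℕ} {p q : MvPolynomial σ K} (hp : WB w k p) (hq : WB w l q) :
    WB w (k + l) (p * q) := fun y hy => by
  classical
  rw [coeff_mul] at hy
  obtain ⟨x, hx, hne⟩ := Finset.exists_ne_zero_of_sum_ne_zero hy
  rw [Finset.HasAntidiagonal.mem_antidiagonal] at hx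
  rw [← hx, map_add]
  exact add_le_add (hp _ (left_ne_zero_of_mul hne)) (hq _ (right_ne_zero_of_mul hne))

lemma WB.var {k : ℕ} (e : σ) (h : w e ≤ k) : WB w k (X e : MvPolynomial σ K) := fun y hy => by
  classical
  rw [coeff_X] at hy
  have : Finsupp.single e 1 = y := by by_contra h; simp [h] at hy
  rw [← this, Finsupp.weight_single]; simpa using h

lemma WB.sum {ι : Type*} {k : ℕ} (s : Finset ι) (f : ι → MvPolynomial σ K)
    (h : ∀ i ∈ s, WB w k (f i)) : WB w k (∑ i ∈ s, f i) := by
  classical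
  induction s using Finset.induction_on with
  | empty => simpa using WB.zero w k
  | insert a s ha ih =>
    rw [Finset.sum_insert ha]
    exact WB.add w (h a (by simp)) (ih fun i hi => h i (by simp [hi]))

lemma WB.prod {ι : Type*} (k : ι → ℕ) (s : Finset ι) (f : ι → MvPolynomial σ K)
    (h : ∀ i ∈ s, WB w (k i) (f i)) : WB w (∑ i ∈ s, k i) (∏ i ∈ s, f i) := by
  classical
  induction s using Finset.induction_on with
  | empty => simpa using WB.one w 0
  | insert a s ha ih =>
    rw [Finset.sum_insert ha, Finset.prod_insert ha]
    exact WB.mul w (h a (by simp)) (ih fun i hi => h i (by simp [hi]))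

lemma WB.det {ι : Type*} [Fintype ι] [DecidableEq ι] (M : Matrix ι ι (MvPolynomial σ K))
    (a b : ι → ℕ) (h : ∀ i j, WB w (a i + b j) (M i j)) :
    WB w (∑ i, a i + ∑ j, b j) M.det := by
  rw [Matrix.det_apply]
  refine WB.sum w _ _ fun τ _ => ?_
  have h1 : WB w (∑ i, (a (τ i) + b i)) (∏ i, M (τ i) i) :=
    WB.prod w _ _ _ fun i _ => h _ _
  rw [Finset.sum_add_distrib, Equiv.sum_comp τ a] at h1
  rcases Int.units_eq_one_or (Equiv.Perm.sign τ) with hs | hs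
  · simpa [hs] using h1
  · rw [hs]; simpa using WB.neg w h1

end WB

/-- weight of a vertex -/
noncomputable def wv {n : ℕ} (v : Fin (n + 1)) (e : E n) : ℕ :=
  open Classical in if v ∈ e.1 then 1 else 0

lemma minor_WB {K : Type*} [Field K] {n r : ℕ} (v : Fin (n + 1)) (rows cols : Fin r → Fin n) :
    WB (wv v) 2 ((Dmatrix K n).submatrix rows cols).det := by
  classical
  set DX : Fin (n+1) → Fin (n+1) → MvPolynomial (E n) K := Dg (fun e => X e) with hDX
  set DA : Fin (n+1) → Fin (n+1) → MvPolynomial (E n) K :=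
    fun i j => if i = v ∨ j = v then 0 else DX i j with hDA
  set al : Fin (n+1) → MvPolynomial (E n) K :=
    fun i => (if i = v then 1 else 0) - (if Fin.last n = v then 1 else 0) with hal
  set x : Fin (n+1) → MvPolynomial (E n) K := fun i => DX v i - DX v (Fin.last n) with hx
  have wDX : ∀ i j, WB (wv v) 1 (DX i j) := by
    intro i j
    simp only [hDX, Dg]
    split_ifs
    · exact WB.zero _ _
    · exact WB.var _ _ (by unfold wv; split_ifs <;> simp)
  have wDA : ∀ i j, WB (wv v) 0 (DA i j) := by
    intro i j
    simp only [hDA, hDX, Dg]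
    split_ifs with h1 h2
    · exact WB.zero _ _
    · exact WB.zero _ _
    · refine WB.var _ _ ?_
      unfold wv
      push Not at h1
      simp [mkE, h1.1.symm, h1.2.symm]
  have wal : ∀ k i, WB (wv v) k (al i) := by
    intro k i
    simp only [hal]
    refine WB.sub _ ?_ ?_ <;> split_ifs <;> first | exact WB.zero _ _ | exact WB.one _ _
  have wx : ∀ i, WB (wv v) 1 (x i) := fun i => WB.sub _ (wDX _ _) (wDX _ _)
  set A : Matrix (Fin r) (Fin r) (MvPolynomial (E n) K) := Matrix.of fun k l =>
    DA (rows k).castSucc (cols l).castSucc - DA (rows k).castSucc (Fin.last n)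
      - DA (cols l).castSucc (Fin.last n) with hA
  set U : Matrix (Fin r) (Fin 2) (MvPolynomial (E n) K) := Matrix.of fun k c =>
    if c = 0 then - al (rows k).castSucc else - x (rows k).castSucc with hU
  set W : Matrix (Fin 2) (Fin r) (MvPolynomial (E n) K) := Matrix.of fun c l =>
    if c = 0 then x (cols l).castSucc else al (cols l).castSucc with hW
  have key : (Dmatrix K n).submatrix rows cols = A - U * W := by
    rw [Dmatrix_eq]
    ext1 k l
    have hc : ∀ i, DX i v = DX v i := fun i => Dg_comm _ _ _
    have hs : ∀ i, DX i i = 0 := fun i => Dg_self _ _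
    simp only [Matrix.submatrix_apply, GB, Matrix.of_apply, Matrix.sub_apply, Matrix.mul_apply,
      Fin.sum_univ_two, hA, hU, hW, ← hDX]
    simp only [hDA, hal, hx, if_true, Fin.one_eq_zero_iff, Nat.reduceEqDiff, if_false]
    by_cases h1 : (rows k).castSucc = v <;> by_cases h2 : (cols l).castSucc = v <;>
      by_cases h3 : Fin.last n = v <;> simp [h1, h2, h3, hc, hs] <;> ring
  rw [key, ← Matrix.det_fromBlocks_one₂₂]
  have := WB.det (wv v) (Matrix.fromBlocks A U W 1)
    (Sum.elim (fun _ => 0) (fun c => if c = 0 then 1 else 0))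
    (Sum.elim (fun _ => 0) (fun c => if c = 0 then 0 else 1)) ?_
  · simpa using this
  · rintro (i | i) (j | j)
    · simp only [Matrix.fromBlocks_apply₁₁, hA, Matrix.of_apply, Sum.elim_inl]
      exact WB.sub _ (WB.sub _ (wDA _ _) (wDA _ _)) (wDA _ _)
    · simp only [Matrix.fromBlocks_apply₁₂, hU, Matrix.of_apply, Sum.elim_inl, Sum.elim_inr]
      split_ifs
      · exact WB.neg _ (wal _ _)
      · exact WB.neg _ (wx _)
    · simp only [Matrix.fromBlocks_apply₂₁, hW, Matrix.of_apply, Sum.elim_inl, Sum.elim_inr]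
      split_ifs
      · exact wx _
      · exact wal _ _
    · simp only [Matrix.fromBlocks_apply₂₂, Matrix.one_apply]
      split_ifs <;> first | exact WB.zero _ _ | exact WB.one _ _

lemma det_homog {σ K : Type*} [CommRing K] {r : ℕ} (M : Matrix (Fin r) (Fin r) (MvPolynomial σ K))
    (h : ∀ i j, (M i j).IsHomogeneous 1) : M.det.IsHomogeneous r := by
  rw [Matrix.det_apply]
  refine IsHomogeneous.sum _ _ _ fun τ _ => ?_
  have h1 : (∏ i, M (τ i) i).IsHomogeneous r := by
    simpa using IsHomogeneous.prod Finset.univ (fun i => M (τ i) i) (fun _ => 1)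
      (fun i _ => h _ _)
  rcases Int.units_eq_one_or (Equiv.Perm.sign τ) with hs | hs
  · simpa [hs] using h1
  · rw [hs]; simpa using h1.neg

lemma Dg_homog {K : Type*} [Field K] {n : ℕ} (i j : Fin (n+1)) :
    (Dg (fun e => (X e : MvPolynomial (E n) K)) i j).IsHomogeneous 1 := by
  unfold Dg
  split_ifs
  · exact isHomogeneous_zero _ _ _
  · exact isHomogeneous_X _ _

lemma GB_homog {K : Type*} [Field K] {n : ℕ} {ι : Type*} (b : Fin (n+1)) (rows cols : ι → Fin (n+1))
    (i j : ι) :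
    (GB (fun e => (X e : MvPolynomial (E n) K)) b rows cols i j).IsHomogeneous 1 :=
  ((Dg_homog _ _).sub (Dg_homog _ _)).sub (Dg_homog _ _)

noncomputable def II (K : Type*) [Field K] (n r : ℕ) : Ideal (MvPolynomial (E n) K) :=
  Ideal.span {q | ∃ rows cols : Fin r → Fin n, q = ((Dmatrix K n).submatrix rows cols).det}

lemma II_coeff {K : Type*} [Field K] {n r : ℕ} (v : Fin (n + 1)) (q : MvPolynomial (E n) K)
    (hq : q ∈ II K n r) : ∀ y, coeff y q ≠ 0 → r ≤ y.degree ∧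
      (y.degree = r → Finsupp.weight (wv v) y ≤ 2) := by
  classical
  unfold II at hq
  induction hq using Submodule.span_induction with
  | mem q hq =>
    obtain ⟨rows, cols, rfl⟩ := hq
    intro y hy
    refine ⟨?_, fun _ => minor_WB v rows cols y hy⟩
    have : (((Dmatrix K n).submatrix rows cols).det).IsHomogeneous r := by
      apply det_homog
      intro i j
      rw [Dmatrix_eq]
      exact GB_homog _ _ _ _ _
    have := this hy
    rw [Finsupp.degree_eq_weight_one]
    exact this.ge
  | zero => intro y hy; simp at hy
  | add p q _ _ hp hq =>
    intro y hy
    by_cases h : coeff y p = 0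
    · exact hq y (by simpa [h] using hy)
    · exact hp y h
  | smul a q _ hq =>
    intro y hy
    rw [smul_eq_mul, coeff_mul] at hy
    obtain ⟨x, hx, hne⟩ := Finset.exists_ne_zero_of_sum_ne_zero hy
    rw [Finset.HasAntidiagonal.mem_antidiagonal] at hx
    have h2 := hq _ (right_ne_zero_of_mul hne)
    have hd : y.degree = x.1.degree + x.2.degree := by rw [← hx, map_add]
    refine ⟨by omega, fun h => ?_⟩
    have h0 : x.1.degree = 0 := by omega
    rw [Finsupp.degree_eq_zero_iff] at h0
    have : y = x.2 := by rw [← hx, h0, zero_add]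
    rw [this] at h ⊢
    exact h2.2 h

lemma det_mul_mem {R : Type*} [CommRing R] (I : Ideal R) {r n : ℕ}
    (P : Matrix (Fin r) (Fin n) R) (N : Matrix (Fin n) (Fin r) R)
    (h : ∀ f : Fin r → Fin n, (N.submatrix f id).det ∈ I) : (P * N).det ∈ I := by
  have : (P * N).det = ∑ f : Fin r → Fin n, (∏ i, P i (f i)) * (N.submatrix f id).det := by
    have h1 : P * N = fun i => ∑ j, P i j • N j := by
      ext i j; simp [Matrix.mul_apply]
    rw [h1]
    change Matrix.detRowAlternating (fun i => ∑ j, P i j • N j) = _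
    rw [← AlternatingMap.coe_multilinearMap, MultilinearMap.map_sum]
    refine Finset.sum_congr rfl fun f _ => ?_
    rw [MultilinearMap.map_smul_univ]
    rfl
  rw [this]
  exact I.sum_mem fun f _ => I.mul_mem_left _ (h f)

lemma GB_mem {K : Type*} [Field K] {n r : ℕ} (b : Fin (n+1)) (rows cols : Fin r → Fin (n+1)) :
    (GB (fun e => (X e : MvPolynomial (E n) K)) b rows cols).det ∈ II K n r := by
  classical
  set F : (Fin r → Fin (n+1)) → Matrix (Fin r) (Fin n) (MvPolynomial (E n) K) := fun s =>
    Matrix.of fun k i => (if s k = i.castSucc then 1 else 0) - (if b = i.castSucc then 1 else 0)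
    with hF
  have key : GB (fun e => (X e : MvPolynomial (E n) K)) b rows cols
      = F rows * (Dmatrix K n * (F cols).transpose) := by
    rw [Dmatrix_eq]
    set DX : Fin (n+1) → Fin (n+1) → MvPolynomial (E n) K := Dg (fun e => X e) with hDX
    have hc : ∀ i j, DX i j = DX j i := fun i j => Dg_comm _ _ _
    have hs : ∀ i, DX i i = 0 := fun i => Dg_self _ _
    have sumlem : ∀ (s : Fin (n+1)) (f : Fin (n+1) → MvPolynomial (E n) K), f (Fin.last n) = 0 →
        ∑ i : Fin n, (if s = i.castSucc then 1 else 0) * f i.castSucc = f s := by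
      intro s f hf
      have : ∑ i : Fin (n+1), (if s = i then 1 else 0) * f i = f s := by simp
      rw [Fin.sum_univ_castSucc, hf] at this
      simpa using this
    ext1 k l
    set G : Fin (n+1) → Fin (n+1) → MvPolynomial (E n) K :=
      fun i j => DX i j - DX i (Fin.last n) - DX j (Fin.last n) with hG
    have hG1 : ∀ i, G i (Fin.last n) = 0 := fun i => by simp [hG, hs]
    have hG2 : ∀ i, G (Fin.last n) i = 0 := fun i => by simp [hG, hs, hc i]
    have hin : ∀ i s, ∑ j : Fin n, G i j.castSucc *
        ((if s = j.castSucc then 1 else 0) - (if b = j.castSucc then 1 else 0)) =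
        G i s - G i b := by
      intro i s
      rw [← sumlem s (G i) (hG1 i), ← sumlem b (G i) (hG1 i), ← Finset.sum_sub_distrib]
      exact Finset.sum_congr rfl fun _ _ => by ring
    have hout : ∀ t s, ∑ i : Fin n,
        ((if t = i.castSucc then 1 else 0) - (if b = i.castSucc then 1 else 0)) *
          (G i.castSucc s - G i.castSucc b) =
        (G t s - G t b) - (G b s - G b b) := by
      intro t s
      rw [← sumlem t (fun i => G i s - G i b) (by simp [hG2]),
        ← sumlem b (fun i => G i s - G i b) (by simp [hG2]), ← Finset.sum_sub_distrib]
      exact Finset.sum_congr rfl fun _ _ => by ring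
    have e1 : (F rows * (GB (fun e => (X e : MvPolynomial (E n) K)) (Fin.last n)
        Fin.castSucc Fin.castSucc * (F cols).transpose)) k l =
        ∑ i : Fin n,
        ((if rows k = i.castSucc then 1 else 0) - (if b = i.castSucc then 1 else 0)) *
        ∑ j : Fin n, G i.castSucc j.castSucc *
        ((if cols l = j.castSucc then 1 else 0) - (if b = j.castSucc then 1 else 0)) := rfl
    rw [e1]
    simp only [hin, hout]
    simp only [GB, Matrix.of_apply, ← hDX, hG]
    rw [hs b, hc b (cols l)]
    ring
  rw [key]
  refine det_mul_mem _ _ _ fun f => ?_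
  have : ((Dmatrix K n * (F cols).transpose).submatrix f id).det =
      (F cols * ((Dmatrix K n).submatrix f id).transpose).det := by
    rw [← Matrix.det_transpose]
    congr 1
    rw [← Matrix.transpose_transpose (F cols), ← Matrix.transpose_mul, Matrix.transpose_transpose]
    rfl
  rw [this]
  refine det_mul_mem _ _ _ fun f' => ?_
  refine Ideal.subset_span ⟨f, f', ?_⟩
  rw [← Matrix.det_transpose]
  rfl

lemma GB_map {R S : Type*} [Ring R] [Ring S] {n : ℕ} {ι : Type*} [Fintype ι] [DecidableEq ι] (f : R →+* S) (g : E n → R)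
    (b : Fin (n + 1)) (rows cols : ι → Fin (n + 1)) :
    f.mapMatrix (GB g b rows cols) = GB (fun e => f (g e)) b rows cols := by
  ext1 i j
  simp [GB, Dg_map]

lemma natDegree_aeval_le {σ K : Type*} [Field K] (w : σ → ℕ) (k : ℕ) (p : MvPolynomial σ K)
    (hp : WB w k p) (h : σ → Polynomial K) (hh : ∀ e, (h e).natDegree ≤ w e) :
    (aeval h p).natDegree ≤ k := by
  rw [aeval_def, eval₂_eq]
  refine Polynomial.natDegree_sum_le_of_forall_le _ _ fun y hy => ?_
  refine (Polynomial.natDegree_C_mul_le _ _).trans ?_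
  refine (Polynomial.natDegree_prod_le _ _).trans ?_
  refine le_trans ?_ (hp y (mem_support_iff.mp hy))
  rw [Finsupp.weight_apply, Finsupp.sum]
  refine Finset.sum_le_sum fun i _ => ?_
  refine Polynomial.natDegree_pow_le.trans ?_
  simpa using Nat.mul_le_mul_left _ (hh i)

lemma main_deg {K : Type*} [Field K] {n r : ℕ} (φ : Equiv.Perm (E n))
    (hφ : ∀ q ∈ II K n r, rename φ q ∈ II K n r) (v : Fin (n+1)) (g : E n → Polynomial K)
    (hg : ∀ e, (g e).natDegree ≤ wv v (φ e)) (b : Fin (n+1)) (rows cols : Fin r → Fin (n+1)) :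
    (GB g b rows cols).det.natDegree ≤ 2 := by
  set q := (GB (fun e => (X e : MvPolynomial (E n) K)) b rows cols).det with hq
  have hqI : q ∈ II K n r := GB_mem b rows cols
  have hqh : q.IsHomogeneous r := det_homog _ fun i j => GB_homog _ _ _ _ _
  have hph : (rename φ q).IsHomogeneous r := hqh.rename_isHomogeneous
  have hW : WB (wv v) 2 (rename φ q) := by
    intro y hy
    refine (II_coeff v _ (hφ q hqI) y hy).2 ?_
    rw [Finsupp.degree_eq_weight_one]
    exact hph hy
  have h1 := natDegree_aeval_le (wv v) 2 _ hW (fun e => g (φ.symm e)) (fun e => by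
    simpa using hg (φ.symm e))
  rw [aeval_rename] at h1
  have h2 : ((fun e => g (φ.symm e)) ∘ φ) = g := by ext1 e; simp
  rw [h2] at h1
  have h3 : aeval g q = (GB g b rows cols).det := by
    have := RingHom.map_det (aeval (R := K) g).toRingHom
      (GB (fun e => (X e : MvPolynomial (E n) K)) b rows cols)
    rw [GB_map] at this
    simpa [hq] using this
  rwa [h3] at h1

lemma core_det {R : Type*} [CommRing R] {n k : ℕ} (g : E n → R) (κ : R) (hκ : 2 * κ = -1)
    (c : Fin 3 → Fin (n+1)) (b : Fin (n+1)) (ext : Fin k → Fin (n+1))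
    (h1 : ∀ i a, Dg g (ext i) (c a) = κ) (h2 : ∀ i, Dg g (ext i) b = κ)
    (h3 : ∀ i j, i ≠ j → Dg g (ext i) (ext j) = 2 * κ) :
    (GB g b (Sum.elim c ext) (Sum.elim c ext)).det =
      (Matrix.of fun a a' => Dg g (c a) (c a') - Dg g (c a) b - Dg g (c a') b
        - k * (Dg g (c a) b * Dg g (c a') b)).det := by
  have : GB g b (Sum.elim c ext) (Sum.elim c ext) = Matrix.fromBlocks
      (Matrix.of fun a a' => Dg g (c a) (c a') - Dg g (c a) b - Dg g (c a') b)
      (Matrix.of fun a _ => - Dg g (c a) b) (Matrix.of fun _ a => - Dg g (c a) b) 1 := by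
    ext1 i j
    rcases i with i | i <;> rcases j with j | j
    · simp [GB]
    · simp [GB, h2, Dg_comm g (c i) (ext j), h1]
    · simp [GB, h2, h1]
    · simp only [GB, Matrix.of_apply, Sum.elim_inr, h2, Matrix.fromBlocks_apply₂₂,
        Matrix.one_apply]
      split_ifs with h
      · subst h; rw [Dg_self]; linear_combination -hκ
      · rw [h3 _ _ h]; ring
  rw [this, Matrix.det_fromBlocks_one₂₂]
  congr 1
  ext1 a a'
  simp [Matrix.mul_apply]

open Classical in
lemma combine {K : Type*} [Field K] (hc2 : (2 : K) ≠ 0) {n r : ℕ} (hr3 : 3 ≤ r) (hrn : r ≤ n)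
    (φ : Equiv.Perm (E n))
    (hφ : ∀ q ∈ II K n r, rename φ q ∈ II K n r) (v : Fin (n+1)) (T : Set (E n))
    (hT : ∀ e ∈ T, v ∈ (φ e).1) (c : Fin 3 → Fin (n+1)) (b : Fin (n+1))
    (hcore : ∀ e ∈ T, ∀ z ∈ e.1, z = b ∨ ∃ a, z = c a)
    (τ : Fin (n+1) → Fin (n+1) → Polynomial K)
    (hτ : τ = Dg (fun e => if e ∈ T then Polynomial.X else 0)) :
    ∃ k : ℕ, (Matrix.of fun a a' => τ (c a) (c a') - τ (c a) b - τ (c a') b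
        - k * (τ (c a) b * τ (c a') b)).det.natDegree ≤ 2 := by
  obtain ⟨k, rfl⟩ := Nat.exists_eq_add_of_le hr3
  refine ⟨k, ?_⟩
  set S : Finset (Fin (n+1)) := insert b (Finset.univ.image c) with hS
  have hScard : S.card ≤ 4 := by
    refine (Finset.card_insert_le _ _).trans ?_
    have : (Finset.univ.image c).card ≤ 3 := by simpa using Finset.card_image_le (s := Finset.univ) (f := c)
    omega
  have hle : Fintype.card (Fin k) ≤ Fintype.card {z // z ∈ Sᶜ} := by
    rw [Fintype.card_coe, Finset.card_compl]; simp; omega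
  obtain ⟨emb⟩ := Function.Embedding.nonempty_of_card_le hle
  set ext : Fin k → Fin (n+1) := fun i => (emb i).1 with hext
  have hextS : ∀ i, ext i ∉ S := fun i => Finset.mem_compl.mp (emb i).2
  have hextinj : ∀ i j, i ≠ j → ext i ≠ ext j := fun i j h h' => h (emb.injective (Subtype.ext h'))
  have hbS : b ∈ S := by simp [hS]
  have hcS : ∀ a, c a ∈ S := by simp [hS]
  set κ : Fin (n+1) → K := fun i => if i ∈ S then 0 else -(1/2) with hκ
  set g : E n → Polynomial K := fun e => if e ∈ T then Polynomial.X else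
    Polynomial.C (Sym2.lift ⟨fun i j => κ i + κ j, fun _ _ => add_comm _ _⟩ e.1) with hg
  have hgdeg : ∀ e, (g e).natDegree ≤ wv v (φ e) := by
    intro e
    simp only [hg]
    split_ifs with h
    · simp [wv, hT e h]
    · simp
  have hTS : ∀ i j (h : i ≠ j), i ∉ S → mkE i j h ∉ T := by
    intro i j h hi hT'
    apply hi
    rcases hcore _ hT' i (by simp [mkE]) with h | ⟨a, h⟩
    · rw [h]; exact hbS
    · rw [h]; exact hcS a
  have hgS : ∀ i j, i ≠ j → i ∉ S → Dg g i j = Polynomial.C (κ i + κ j) := by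
    intro i j h hi
    simp only [Dg, dif_neg h, hg, if_neg (hTS i j h hi)]
    simp [mkE]
  have hgc : ∀ i j, i ∈ S → j ∈ S → Dg g i j = τ i j := by
    intro i j hi hj
    rw [hτ]
    simp only [Dg, hg]
    split_ifs <;> simp [mkE, hκ, hi, hj]
  have ne1 : ∀ i z, z ∈ S → ext i ≠ z := fun i z hz h => hextS i (h ▸ hz)
  have hd := core_det g (Polynomial.C (-(1/2) : K)) (by
      rw [← Polynomial.C_ofNat, ← Polynomial.C_mul]; field_simp; simp) c b ext
    (fun i a => by rw [hgS _ _ (ne1 i _ (hcS a)) (hextS i)]; simp [hκ, hextS i, hcS a])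
    (fun i => by rw [hgS _ _ (ne1 i _ hbS) (hextS i)]; simp [hκ, hextS i, hbS])
    (fun i j h => by
      rw [hgS _ _ (hextinj i j h) (hextS i)]; simp [hκ, hextS i, hextS j]; ring)
  simp only [hgc _ _ (hcS _) (hcS _), hgc _ _ (hcS _) hbS] at hd
  rw [← hd]
  have h5 := main_deg φ hφ v g hgdeg b (Sum.elim c ext ∘ finSumFinEquiv.symm)
    (Sum.elim c ext ∘ finSumFinEquiv.symm)
  have h6 : GB g b (Sum.elim c ext ∘ finSumFinEquiv.symm) (Sum.elim c ext ∘ finSumFinEquiv.symm)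
    = (GB g b (Sum.elim c ext) (Sum.elim c ext)).submatrix finSumFinEquiv.symm
        finSumFinEquiv.symm := rfl
  rwa [h6, Matrix.det_submatrix_equiv_self] at h5

lemma factA {K : Type*} [Field K] (hc2 : (2 : K) ≠ 0) {n r : ℕ} (hr3 : 3 ≤ r) (hrn : r ≤ n)
    (φ : Equiv.Perm (E n))
    (hφ : ∀ q ∈ II K n r, rename φ q ∈ II K n r) (u w x b : Fin (n+1))
    (huw : u ≠ w) (hux : u ≠ x) (hub : u ≠ b) (hwx : w ≠ x) (hwb : w ≠ b) (hxb : x ≠ b)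
    (v : Fin (n+1)) (h1 : v ∈ (φ (mkE u w huw)).1) (h2 : v ∈ (φ (mkE x b hxb)).1) : False := by
  classical
  set τ : Fin (n+1) → Fin (n+1) → Polynomial K :=
    Dg (fun e => if e ∈ ({mkE u w huw, mkE x b hxb} : Set (E n)) then Polynomial.X else 0) with hτ
  obtain ⟨k, hk⟩ := combine hc2 hr3 hrn φ hφ v {mkE u w huw, mkE x b hxb} (by
    rintro e (rfl | rfl) <;> assumption) ![u, w, x] b (by
    rintro e (rfl | rfl) z hz <;> simp [mkE] at hz <;> rcases hz with rfl | rfl <;>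
      simp [Fin.exists_fin_succ]) τ (by rw [hτ]; congr!)
  have t1 : τ u w = Polynomial.X := by simp [hτ, Dg, huw]
  have t2 : τ x b = Polynomial.X := by simp [hτ, Dg, hxb]
  have t3 : τ u x = 0 := by simp [hτ, Dg, mkE, huw, hux, hub, hwx, hwb, hxb, hwx.symm]
  have t4 : τ w x = 0 := by simp [hτ, Dg, mkE, huw, hux, hub, hwx, hwb, hxb, hux.symm, huw.symm]
  have t5 : τ u b = 0 := by simp [hτ, Dg, mkE, huw, hux, hub, hwx, hwb, hxb, hwb.symm]
  have t6 : τ w b = 0 := by simp [hτ, Dg, mkE, huw, hux, hub, hwx, hwb, hxb, hub.symm, huw.symm]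
  have hs : ∀ i, τ i i = 0 := fun i => Dg_self _ _
  have hcm : ∀ i j, τ i j = τ j i := fun i j => Dg_comm _ _ _
  have key := Polynomial.coeff_eq_zero_of_natDegree_lt (n := 3) (Nat.lt_succ_of_le hk)
  rw [Matrix.det_fin_three] at key
  simp only [Matrix.of_apply, Matrix.cons_val_zero, Matrix.cons_val_one, Matrix.cons_val,
    hs, hcm w u, hcm x u, hcm x w, t1, t2, t3, t4, t5, t6] at key
  ring_nf at key
  have e : ∀ p : Polynomial K, p = Polynomial.C 4 * Polynomial.X ^ 3 +
      Polynomial.C (k : K) * Polynomial.X ^ 4 → p.coeff 3 = 0 → False := by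
    rintro p rfl h
    simp [Polynomial.coeff_X_pow] at h
    have : (4 : K) = 2 * 2 := by norm_num
    rw [this] at h
    exact hc2 (mul_self_eq_zero.mp h)
  refine e _ ?_ key
  simp only [Polynomial.C_ofNat, map_natCast]
  ring

lemma factB {K : Type*} [Field K] (hc2 : (2 : K) ≠ 0) {n r : ℕ} (hr3 : 3 ≤ r) (hrn : r ≤ n)
    (φ : Equiv.Perm (E n))
    (hφ : ∀ q ∈ II K n r, rename φ q ∈ II K n r) (u w x : Fin (n+1))
    (huw : u ≠ w) (hux : u ≠ x) (hwx : w ≠ x)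
    (v : Fin (n+1)) (h1 : v ∈ (φ (mkE u w huw)).1) (h2 : v ∈ (φ (mkE u x hux)).1)
    (h3 : v ∈ (φ (mkE w x hwx)).1) : False := by
  classical
  obtain ⟨b, hb⟩ : ∃ b, b ∉ ({u, w, x} : Finset (Fin (n+1))) := by
    by_contra! h
    have h1 : (Finset.univ : Finset (Fin (n+1))) ⊆ {u, w, x} := fun z _ => h z
    have h2 := Finset.card_le_card h1
    have h3 := Finset.card_le_three (a := u) (b := w) (c := x)
    simp at h2
    omega
  simp only [Finset.mem_insert, Finset.mem_singleton, not_or] at hb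
  obtain ⟨hbu, hbw, hbx⟩ := hb
  set τ : Fin (n+1) → Fin (n+1) → Polynomial K :=
    Dg (fun e => if e ∈ ({mkE u w huw, mkE u x hux, mkE w x hwx} : Set (E n))
      then Polynomial.X else 0) with hτ
  obtain ⟨k, hk⟩ := combine hc2 hr3 hrn φ hφ v {mkE u w huw, mkE u x hux, mkE w x hwx} (by
    rintro e (rfl | rfl | rfl) <;> assumption) ![u, w, x] b (by
    rintro e (rfl | rfl | rfl) z hz <;> simp [mkE] at hz <;> rcases hz with rfl | rfl <;>
      simp [Fin.exists_fin_succ]) τ (by rw [hτ]; congr!)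
  have t1 : τ u w = Polynomial.X := by simp [hτ, Dg, huw]
  have t2 : τ u x = Polynomial.X := by simp [hτ, Dg, hux]
  have t3 : τ w x = Polynomial.X := by simp [hτ, Dg, hwx]
  have t4 : τ u b = 0 := by simp [hτ, Dg, mkE, huw, hux, hwx, hbu, hbw, hbx]
  have t5 : τ w b = 0 := by simp [hτ, Dg, mkE, huw, hux, hwx, hbu, hbw, hbx]
  have t6 : τ x b = 0 := by simp [hτ, Dg, mkE, huw, hux, hwx, hbu, hbw, hbx]
  have hs : ∀ i, τ i i = 0 := fun i => Dg_self _ _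
  have hcm : ∀ i j, τ i j = τ j i := fun i j => Dg_comm _ _ _
  have key := Polynomial.coeff_eq_zero_of_natDegree_lt (n := 3) (Nat.lt_succ_of_le hk)
  rw [Matrix.det_fin_three] at key
  simp only [Matrix.of_apply, Matrix.cons_val_zero, Matrix.cons_val_one, Matrix.cons_val,
    hs, hcm w u, hcm x u, hcm x w, t1, t2, t3, t4, t5, t6] at key
  have e : ∀ p : Polynomial K, p = Polynomial.C 2 * Polynomial.X ^ 3 → p.coeff 3 = 0 → False := by
    rintro p rfl h
    simp at h
    exact hc2 h
  refine e _ ?_ key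
  simp only [Polynomial.C_ofNat, map_natCast]
  ring

lemma exists_mkE {n : ℕ} (e : E n) (w : Fin (n+1)) (h : w ∈ e.1) :
    ∃ p, ∃ hp : w ≠ p, e = mkE w p hp := by
  obtain ⟨p, hp⟩ := h
  refine ⟨p, ?_, Subtype.ext hp⟩
  rintro rfl
  exact e.2 (by rw [hp]; simp)

lemma factA' {K : Type*} [Field K] (hc2 : (2 : K) ≠ 0) {n r : ℕ} (hr3 : 3 ≤ r) (hrn : r ≤ n)
    (φ : Equiv.Perm (E n))
    (hφ : ∀ q ∈ II K n r, rename φ q ∈ II K n r) (e f : E n) (v : Fin (n+1))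
    (he : v ∈ (φ e).1) (hf : v ∈ (φ f).1) : ∃ z, z ∈ e.1 ∧ z ∈ f.1 := by
  by_contra! h
  obtain ⟨⟨u, w⟩, heq⟩ : ∃ p : Fin (n+1) × Fin (n+1), s(p.1, p.2) = e.1 := by
    rcases e with ⟨⟨p⟩, _⟩; exact ⟨p, rfl⟩
  obtain ⟨⟨x, b⟩, hfeq⟩ : ∃ p : Fin (n+1) × Fin (n+1), s(p.1, p.2) = f.1 := by
    rcases f with ⟨⟨p⟩, _⟩; exact ⟨p, rfl⟩
  simp only at heq hfeq
  have huw : u ≠ w := by rintro rfl; exact e.2 (by rw [← heq]; simp)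
  have hxb : x ≠ b := by rintro rfl; exact f.2 (by rw [← hfeq]; simp)
  have e1 : e = mkE u w huw := Subtype.ext heq.symm
  have f1 : f = mkE x b hxb := Subtype.ext hfeq.symm
  rw [← heq, ← hfeq] at h
  have hu := h u (by simp)
  have hw := h w (by simp)
  simp only [Sym2.mem_iff, not_or] at hu hw
  rw [e1] at he
  rw [f1] at hf
  exact factA hc2 hr3 hrn φ hφ u w x b huw hu.1 hu.2 hw.1 hw.2 hxb v he hf

lemma exists_avoid {n : ℕ} (hn : 3 ≤ n) (u w x : Fin (n+1)) :
    ∃ b, b ≠ u ∧ b ≠ w ∧ b ≠ x := by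
  classical
  by_contra! h
  have h1 : (Finset.univ : Finset (Fin (n+1))) ⊆ {u, w, x} := fun z _ => by
    have := h z
    simp only [Finset.mem_insert, Finset.mem_singleton]
    tauto
  have h2 := Finset.card_le_card h1
  have h3 := Finset.card_le_three (a := u) (b := w) (c := x)
  simp at h2
  omega

lemma inv_stable {K : Type*} [Field K] {n r : ℕ} (φ : Equiv.Perm (E n))
    (hφ : ∀ q ∈ II K n r, rename φ q ∈ II K n r) :
    ∀ q ∈ II K n r, rename φ.symm q ∈ II K n r := by
  have hk : ∀ k : ℕ, ∀ q ∈ II K n r, rename (φ ^ k : Equiv.Perm (E n)) q ∈ II K n r := by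
    intro k
    induction k with
    | zero => intro q hq; simpa using hq
    | succ k ih =>
      intro q hq
      have := hφ _ (ih q hq)
      rw [rename_rename] at this
      rw [pow_succ', Equiv.Perm.coe_mul]
      exact this
  have hpos : 0 < orderOf φ := orderOf_pos φ
  have : φ.symm = φ ^ (orderOf φ - 1) := by
    change φ⁻¹ = _
    rw [inv_eq_iff_mul_eq_one, ← pow_succ', Nat.sub_add_cancel hpos, pow_orderOf_eq_one]
  rw [this]
  exact hk _

lemma star {K : Type*} [Field K] (hc2 : (2 : K) ≠ 0) {n r : ℕ} (hr3 : 3 ≤ r) (hrn : r ≤ n)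
    (φ : Equiv.Perm (E n))
    (hφ : ∀ q ∈ II K n r, rename φ q ∈ II K n r) (v : Fin (n+1)) :
    ∃ w, ∀ e : E n, v ∈ e.1 → w ∈ (φ e).1 := by
  have hψ := inv_stable φ hφ
  obtain ⟨a, ha, -, -⟩ := exists_avoid (hr3.trans hrn) v v v
  obtain ⟨b, hb, hba, -⟩ := exists_avoid (hr3.trans hrn) v a a
  have hA : ∀ e f : E n, v ∈ e.1 → v ∈ f.1 → ∃ z, z ∈ (φ e).1 ∧ z ∈ (φ f).1 := fun e f he hf =>
    factA' hc2 hr3 hrn φ.symm hψ (φ e) (φ f) v (by simpa using he) (by simpa using hf)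
  set e1 := mkE v a ha.symm with he1
  set e2 := mkE v b hb.symm with he2
  have hv1 : v ∈ e1.1 := by simp [he1, mkE]
  have hv2 : v ∈ e2.1 := by simp [he2, mkE]
  have h12 : e1 ≠ e2 := by
    intro h
    have := congrArg Subtype.val h
    simp [he1, he2, mkE] at this
    grind
  obtain ⟨w, hw1, hw2⟩ := hA e1 e2 hv1 hv2
  obtain ⟨p, hp, hp'⟩ := exists_mkE _ _ hw1
  obtain ⟨q, hq, hq'⟩ := exists_mkE _ _ hw2
  have hpq : p ≠ q := by
    rintro rfl
    exact h12 (φ.injective (hp'.trans hq'.symm))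
  refine ⟨w, fun e he => ?_⟩
  by_contra hwe
  have hpe : p ∈ (φ e).1 := by
    obtain ⟨z, hz, hz'⟩ := hA e e1 he hv1
    rw [hp'] at hz'
    simp only [mkE, Sym2.mem_iff] at hz'
    rcases hz' with rfl | rfl
    · exact absurd hz hwe
    · exact hz
  have hqe : q ∈ (φ e).1 := by
    obtain ⟨z, hz, hz'⟩ := hA e e2 he hv2
    rw [hq'] at hz'
    simp only [mkE, Sym2.mem_iff] at hz'
    rcases hz' with rfl | rfl
    · exact absurd hz hwe
    · exact hz
  have hpqe : φ e = mkE p q hpq := Subtype.ext ((Sym2.mem_and_mem_iff hpq).mp ⟨hpe, hqe⟩)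
  refine factB hc2 hr3 hrn φ.symm hψ w p q hp hq hpq v ?_ ?_ ?_
  · rw [← hp']; simpa using hv1
  · rw [← hq']; simpa using hv2
  · rw [← hpqe]; simpa using he

lemma final {K : Type*} [Field K] (hc2 : (2 : K) ≠ 0) {n r : ℕ} (hr3 : 3 ≤ r) (hrn : r ≤ n)
    (φ : Equiv.Perm (E n))
    (hφ : ∀ q ∈ II K n r, rename φ q ∈ II K n r) :
    ∃ π : Equiv.Perm (Fin (n + 1)), ∀ (i j : Fin (n + 1)) (h : i ≠ j),
      (φ (mkE i j h)).1 = s(π i, π j) := by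
  choose π hπ using star hc2 hr3 hrn φ hφ
  have hinj : Function.Injective π := by
    intro v v' h
    by_contra hne
    obtain ⟨a, ha, ha', -⟩ := exists_avoid (hr3.trans hrn) v v' v'
    obtain ⟨b, hb, hb', hba⟩ := exists_avoid (hr3.trans hrn) v v' a
    have h1 := hπ v (mkE v a ha.symm) (by simp [mkE])
    have h2 := hπ v' (mkE v' b hb'.symm) (by simp [mkE])
    rw [← h] at h2
    obtain ⟨z, hz1, hz2⟩ := factA' hc2 hr3 hrn φ hφ _ _ _ h1 h2
    simp only [mkE, Sym2.mem_iff] at hz1 hz2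
    grind
  refine ⟨Equiv.ofBijective π (Finite.injective_iff_bijective.mp hinj), fun i j h => ?_⟩
  simp only [Equiv.ofBijective_apply]
  exact (Sym2.mem_and_mem_iff (hinj.ne h)).mp
    ⟨hπ i _ (by simp [mkE]), hπ j _ (by simp [mkE])⟩

end Stmt15

theorem stmt15 {K : Type*} [Field K] (h2 : (2 : K) ≠ 0) {n : ℕ} (hn : 4 ≤ n + 1)
    {r : ℕ} (hr3 : 3 ≤ r) (hrn : r ≤ n)
    (I : Ideal (MvPolynomial {p : Sym2 (Fin (n + 1)) // ¬ p.IsDiag} K))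
    (hI : I = Ideal.span {q | ∃ rows cols : Fin r → Fin n,
        q = ((Dmatrix K n).submatrix rows cols).det})
    (φ : Equiv.Perm {p : Sym2 (Fin (n + 1)) // ¬ p.IsDiag})
    (hφ : ∀ q ∈ I, MvPolynomial.rename φ q ∈ I) :
    ∃ π : Equiv.Perm (Fin (n + 1)),
      ∀ (i j : Fin (n + 1)) (h : i ≠ j),
        ((φ ⟨s(i, j), by simpa [Sym2.mk_isDiag_iff] using h⟩ :
          {p : Sym2 (Fin (n + 1)) // ¬ p.IsDiag}) : Sym2 (Fin (n + 1))) = s(π i, π j) := by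
  subst hI
  exact Stmt15.final h2 hr3 hrn φ hφ
end

section
/- Let K be a field of characteristic not 2, n a positive integer, and for 1 <= r <= n-1 let I be the ideal of K[D_{{i,j}} : 1<=i<j<=n] generated by all r-by-r minors of the matrix (D_{{i,j}} - D_{{i,n}} - D_{{j,n}})_{i,j=1..n-1} (with D_{{i,i}} = 0). A degree-r monomial t = product over nu of D_{{i_nu, j_nu}} (nu = 1,...,r) occurs with nonzero coefficient in some polynomial of I if and only if every index k in {1,...,n} appears at most twice among the indices i_1,j_1,...,i_r,j_r. -/
open Matrix in
lemma aux_det_expand {R ι : Type*} [CommRing R] [Fintype ι] [DecidableEq ι] {r : ℕ}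
    (w N : ι → Fin r → R) :
    (Matrix.of fun a c => ∑ p, w p a * N p c).det =
      ∑ f : Fin r → ι, (∏ a, w (f a) a) * (Matrix.of fun a c => N (f a) c).det := by
  have h := (Matrix.detRowAlternating (n := Fin r) (R := R)).toMultilinearMap.map_sum
    (fun (a : Fin r) (p : ι) => w p a • N p)
  have h1 : (fun a => ∑ p, w p a • N p) = (Matrix.of fun a c => ∑ p, w p a * N p c) := by
    ext a c; simp
  rw [h1] at h
  refine h.trans (Finset.sum_congr rfl fun f _ => ?_)
  exact (Matrix.detRowAlternating (n := Fin r) (R := R)).toMultilinearMap.map_smul_univ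
    (fun a => w (f a) a) (fun a => N (f a))

/-- full symmetric matrix -/
noncomputable def DD (K : Type*) [Field K] {n : ℕ} (k l : Fin (n + 1)) :
    MvPolynomial {p : Sym2 (Fin (n + 1)) // ¬ p.IsDiag} K :=
  if h : k = l then 0 else Dvar k l h

lemma DD_symm (K : Type*) [Field K] {n : ℕ} (k l : Fin (n + 1)) : DD K k l = DD K l k := by
  unfold DD
  by_cases h : k = l
  · subst h; rfl
  · rw [dif_neg h, dif_neg (Ne.symm h)]
    unfold Dvar
    congr 2
    exact Sym2.eq_swap

lemma DD_self (K : Type*) [Field K] {n : ℕ} (k : Fin (n + 1)) : DD K k k = 0 := by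
  simp [DD]

lemma Dmatrix_eq (K : Type*) [Field K] {n : ℕ} (k l : Fin n) :
    Dmatrix K n k l = DD K k.castSucc l.castSucc - DD K k.castSucc (Fin.last n)
      - DD K l.castSucc (Fin.last n) := by
  unfold Dmatrix DD
  simp only [Matrix.of_apply, Fin.castSucc_inj]
  rw [dif_neg (Fin.castSucc_lt_last k).ne, dif_neg (Fin.castSucc_lt_last l).ne]

/-- the generalized minor -/
noncomputable def BB {K : Type*} [Field K] {n r : ℕ} (x y : Fin (n + 1) → Fin r → K) :
    MvPolynomial {p : Sym2 (Fin (n + 1)) // ¬ p.IsDiag} K :=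
  (Matrix.of fun c a => ∑ p : Fin (n + 1) × Fin (n + 1),
    (DD K p.1 p.2 * MvPolynomial.C (y p.2 c)) * MvPolynomial.C (x p.1 a)).det

lemma aux_entry {R : Type*} [CommRing R] {n : ℕ} (x y : Fin (n + 1) → R)
    (D : Fin (n + 1) → Fin (n + 1) → R) (h0 : ∀ k, D k k = 0) (hs : ∀ k l, D k l = D l k)
    (hx : x (Fin.last n) = -∑ k : Fin n, x k.castSucc)
    (hy : y (Fin.last n) = -∑ k : Fin n, y k.castSucc) :
    ∑ p : Fin (n + 1) × Fin (n + 1), (D p.1 p.2 * y p.2) * x p.1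
      = ∑ l : Fin n, y l.castSucc * (∑ k : Fin n, x k.castSucc *
        (D k.castSucc l.castSucc - D k.castSucc (Fin.last n) - D l.castSucc (Fin.last n))) := by
  rw [Fintype.sum_prod_type, Fin.sum_univ_castSucc]
  simp only [Fin.sum_univ_castSucc (n := n), hx, hy, h0, hs (Fin.last n) (Fin.castSucc _)]
  have e1 : ∑ k : Fin n, ∑ l : Fin n, D k.castSucc l.castSucc * y l.castSucc *
      x k.castSucc = ∑ l : Fin n, ∑ k : Fin n, y l.castSucc *
      (x k.castSucc * D k.castSucc l.castSucc) := by
    rw [Finset.sum_comm]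
    exact Finset.sum_congr rfl fun _ _ => Finset.sum_congr rfl fun _ _ => by ring
  have e2 : ∑ k : Fin n, D k.castSucc (Fin.last n) * (-∑ l : Fin n, y l.castSucc) *
      x k.castSucc = -∑ l : Fin n, ∑ k : Fin n, y l.castSucc *
      (x k.castSucc * D k.castSucc (Fin.last n)) := by
    simp only [mul_neg, neg_mul, Finset.sum_neg_distrib, neg_inj]
    rw [Finset.sum_comm]
    refine Finset.sum_congr rfl fun k _ => ?_
    rw [← Finset.sum_mul (f := fun l : Fin n => y l.castSucc)]
    ring
  have e3 : ∑ l : Fin n, D l.castSucc (Fin.last n) * y l.castSucc * (-∑ k : Fin n, x k.castSucc)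
      = -∑ l : Fin n, ∑ k : Fin n, y l.castSucc *
      (x k.castSucc * D l.castSucc (Fin.last n)) := by
    simp only [mul_neg, Finset.sum_neg_distrib, neg_inj]
    refine Finset.sum_congr rfl fun l _ => ?_
    simp only [← Finset.mul_sum, ← Finset.sum_mul]
    ring
  rw [Finset.sum_add_distrib, e1, e2, e3]
  simp only [mul_sub, Finset.sum_sub_distrib, Finset.mul_sum]
  ring


open MvPolynomial in
lemma BB_entry {K : Type*} [Field K] {n r : ℕ} (x y : Fin (n + 1) → Fin r → K)
    (hx : ∑ k, x k = 0) (hy : ∑ k, y k = 0) (a c : Fin r) :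
    ∑ p : Fin (n + 1) × Fin (n + 1), (DD K p.1 p.2 * C (y p.2 c)) * C (x p.1 a)
      = ∑ l : Fin n, C (y l.castSucc c) *
          (∑ k : Fin n, C (x k.castSucc a) * Dmatrix K n k l) := by
  have hx' : C (x (Fin.last n) a) = -∑ k : Fin n, (C (x k.castSucc a) :
      MvPolynomial {p : Sym2 (Fin (n + 1)) // ¬ p.IsDiag} K) := by
    have := congrFun hx a
    rw [Fin.sum_univ_castSucc] at this
    simp only [Pi.add_apply, Finset.sum_apply, Pi.zero_apply] at this
    rw [← map_sum, ← map_neg, eq_neg_of_add_eq_zero_right this]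
  have hy' : C (y (Fin.last n) c) = -∑ k : Fin n, (C (y k.castSucc c) :
      MvPolynomial {p : Sym2 (Fin (n + 1)) // ¬ p.IsDiag} K) := by
    have := congrFun hy c
    rw [Fin.sum_univ_castSucc] at this
    simp only [Pi.add_apply, Finset.sum_apply, Pi.zero_apply] at this
    rw [← map_sum, ← map_neg, eq_neg_of_add_eq_zero_right this]
  simp only [Dmatrix_eq]
  exact aux_entry (fun k => C (x k a)) (fun k => C (y k c)) (DD K) (DD_self K) (DD_symm K) hx' hy'

open MvPolynomial in
lemma BB_mem {K : Type*} [Field K] {n r : ℕ} (x y : Fin (n + 1) → Fin r → K)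
    (hx : ∑ k, x k = 0) (hy : ∑ k, y k = 0) :
    BB x y ∈ Ideal.span {q | ∃ rows cols : Fin r → Fin n,
        q = ((Dmatrix K n).submatrix rows cols).det} := by
  unfold BB
  simp only [BB_entry x y hx hy]
  rw [aux_det_expand (fun (l : Fin n) c => C (y l.castSucc c))
    (fun l a => ∑ k : Fin n, C (x k.castSucc a) * Dmatrix K n k l)]
  refine Ideal.sum_mem _ fun f _ => Ideal.mul_mem_left _ _ ?_
  rw [← Matrix.det_transpose]
  have := aux_det_expand (fun (k : Fin n) a => C (x k.castSucc a))
    (fun k (c : Fin r) => Dmatrix K n k (f c))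
  change (Matrix.of fun a c => ∑ k : Fin n, C (x k.castSucc a) * Dmatrix K n k (f c)).det ∈ _
  rw [this]
  refine Ideal.sum_mem _ fun g _ => Ideal.mul_mem_left _ _ (Ideal.subset_span ⟨g, f, rfl⟩)

/-- indicator vectors of a row choice -/
def indv (K : Type*) [Field K] {n r : ℕ} (rows : Fin r → Fin n) : Fin (n + 1) → Fin r → K :=
  Fin.lastCases (fun _ => -1) (fun k a => if rows a = k then 1 else 0)

lemma indv_sum (K : Type*) [Field K] {n r : ℕ} (rows : Fin r → Fin n) :
    ∑ k, indv K rows k = 0 := by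
  rw [Fin.sum_univ_castSucc]
  ext a
  simp [indv]

lemma minor_eq (K : Type*) [Field K] {n r : ℕ} (rows cols : Fin r → Fin n) :
    ((Dmatrix K n).submatrix rows cols).det = BB (indv K rows) (indv K cols) := by
  unfold BB
  simp only [BB_entry _ _ (indv_sum K rows) (indv_sum K cols)]
  rw [← Matrix.det_transpose]
  congr 1
  ext1 c a
  simp [indv, apply_ite MvPolynomial.C]

lemma BB_expand {K : Type*} [Field K] {n r : ℕ} (x y : Fin (n + 1) → Fin r → K) :
    BB x y = ∑ h : Fin r → Fin (n + 1), ∑ g : Fin r → Fin (n + 1),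
      MvPolynomial.C ((∏ c, y (h c) c) * (Matrix.of fun c a => x (g c) a).det) *
        ∏ c, DD K (g c) (h c) := by
  unfold BB
  rw [aux_det_expand (fun (p : Fin (n + 1) × Fin (n + 1)) c =>
    DD K p.1 p.2 * MvPolynomial.C (y p.2 c)) (fun p a => MvPolynomial.C (x p.1 a))]
  rw [Finset.sum_comm, ← Fintype.sum_prod_type', ← (Equiv.arrowProdEquivProdArrow _ _ _).sum_comp]
  refine Finset.sum_congr rfl fun f _ => ?_
  have : (Matrix.of fun c a => (MvPolynomial.C (x (f c).1 a) :
      MvPolynomial {p : Sym2 (Fin (n + 1)) // ¬ p.IsDiag} K)).det =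
      MvPolynomial.C (Matrix.of fun c a => x (f c).1 a).det := by
    rw [RingHom.map_det]; rfl
  rw [this, Finset.prod_mul_distrib]
  simp only [map_mul, map_prod, Equiv.arrowProdEquivProdArrow_apply]
  ring

lemma coeff_prod_DD {K : Type*} [Field K] {n r : ℕ} (g h : Fin r → Fin (n + 1))
    (t : {p : Sym2 (Fin (n + 1)) // ¬ p.IsDiag} →₀ ℕ)
    (hne : MvPolynomial.coeff t (∏ c, DD K (g c) (h c)) ≠ 0) :
    ∃ hgh : ∀ c, g c ≠ h c, t = ∑ c : Fin r, Finsupp.single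
          (⟨s(g c, h c), by simpa [Sym2.mk_isDiag_iff] using hgh c⟩ :
            {p : Sym2 (Fin (n + 1)) // ¬ p.IsDiag}) 1 ∧
      MvPolynomial.coeff t (∏ c, DD K (g c) (h c)) = 1 := by
  have hgh : ∀ c, g c ≠ h c := by
    intro c hc
    apply hne
    rw [Finset.prod_eq_zero (Finset.mem_univ c) (by rw [hc, DD_self])]
    simp
  have key : ∏ c, DD K (g c) (h c) = MvPolynomial.monomial (∑ c : Fin r, Finsupp.single
          (⟨s(g c, h c), by simpa [Sym2.mk_isDiag_iff] using hgh c⟩ :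
            {p : Sym2 (Fin (n + 1)) // ¬ p.IsDiag}) 1) 1 := by
    rw [MvPolynomial.monomial_sum_one]
    refine Finset.prod_congr rfl fun c _ => ?_
    unfold DD
    rw [dif_neg (hgh c)]
    rfl
  refine ⟨hgh, ?_⟩
  rw [key, MvPolynomial.coeff_monomial] at hne ⊢
  split_ifs at hne ⊢ with h1
  · exact ⟨h1.symm, rfl⟩
  · exact absurd rfl hne

lemma coeff_prod_DD_of {K : Type*} [Field K] {n r : ℕ} (g h : Fin r → Fin (n + 1))
    (hgh : ∀ c, g c ≠ h c) :
    MvPolynomial.coeff (∑ c : Fin r, Finsupp.single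
          (⟨s(g c, h c), by simpa [Sym2.mk_isDiag_iff] using hgh c⟩ :
            {p : Sym2 (Fin (n + 1)) // ¬ p.IsDiag}) 1) (∏ c, DD K (g c) (h c)) = 1 := by
  have key : ∏ c, DD K (g c) (h c) = MvPolynomial.monomial (∑ c : Fin r, Finsupp.single
          (⟨s(g c, h c), by simpa [Sym2.mk_isDiag_iff] using hgh c⟩ :
            {p : Sym2 (Fin (n + 1)) // ¬ p.IsDiag}) 1) 1 := by
    rw [MvPolynomial.monomial_sum_one]
    refine Finset.prod_congr rfl fun c _ => ?_
    unfold DD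
    rw [dif_neg (hgh c)]
    rfl
  rw [key, MvPolynomial.coeff_monomial, if_pos rfl]

lemma exists_perm_of_sum_single {α : Type*} {r : ℕ} (e f : Fin r → α)
    (h : ∑ c, Finsupp.single (e c) 1 = ∑ c, (Finsupp.single (f c) 1 : α →₀ ℕ)) :
    ∃ τ : Equiv.Perm (Fin r), ∀ c, f c = e (τ c) := by
  classical
  have hc : ∀ a, Fintype.card {c // f c = a} = Fintype.card {c // e c = a} := by
    intro a
    have := DFunLike.congr_fun h a
    simp only [Finsupp.coe_finsetSum, Finset.sum_apply, Finsupp.single_apply,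
      Finset.sum_boole, Nat.cast_id] at this
    rw [Fintype.card_subtype, Fintype.card_subtype, this]
  refine ⟨Equiv.ofFiberEquiv (f := f) (g := e) fun a => Fintype.equivOfCardEq (hc a), fun c => ?_⟩
  exact (Equiv.ofFiberEquiv_map _ c).symm

lemma card_of_sum_single {n r : ℕ} (i j : Fin r → Fin (n + 1)) (hij : ∀ c, i c ≠ j c)
    (k : Fin (n + 1)) :
    Finsupp.liftAddHom (fun e : {p : Sym2 (Fin (n + 1)) // ¬ p.IsDiag} =>
      if k ∈ e.1 then AddMonoidHom.id ℕ else 0) (∑ c : Fin r, Finsupp.single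
          (⟨s(i c, j c), by simpa [Sym2.mk_isDiag_iff] using hij c⟩ :
            {p : Sym2 (Fin (n + 1)) // ¬ p.IsDiag}) 1) =
    (Finset.univ.filter fun ν => i ν = k).card + (Finset.univ.filter fun ν => j ν = k).card := by
  rw [map_sum, Finset.card_filter, Finset.card_filter, ← Finset.sum_add_distrib]
  refine Finset.sum_congr rfl fun c _ => ?_
  rw [Finsupp.liftAddHom_apply_single]
  have := hij c
  simp only [Sym2.mem_iff]
  by_cases h1 : i c = k
  · have h2 : j c ≠ k := fun h => this (h1.trans h.symm)
    simp [h1, h2]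
  · by_cases h2 : j c = k
    · simp [h1, h2]
    · simp [h1, h2, Ne.symm h1, Ne.symm h2]

lemma BB_homog {K : Type*} [Field K] {n r : ℕ} (x y : Fin (n + 1) → Fin r → K) :
    (BB x y).IsHomogeneous r := by
  rw [BB_expand]
  refine MvPolynomial.IsHomogeneous.sum _ _ _ fun h _ =>
    MvPolynomial.IsHomogeneous.sum _ _ _ fun g _ => MvPolynomial.IsHomogeneous.C_mul ?_ _
  have := MvPolynomial.IsHomogeneous.prod Finset.univ (fun c => DD K (g c) (h c)) (fun _ => 1) ?_
  · simpa using this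
  · intro c _
    unfold DD
    split_ifs
    · exact MvPolynomial.isHomogeneous_zero _ _ _
    · exact MvPolynomial.isHomogeneous_X _ _

lemma coeff_BB {K : Type*} [Field K] {n r : ℕ} (x y : Fin (n + 1) → Fin r → K)
    (t : {p : Sym2 (Fin (n + 1)) // ¬ p.IsDiag} →₀ ℕ) :
    MvPolynomial.coeff t (BB x y) = ∑ h : Fin r → Fin (n + 1), ∑ g : Fin r → Fin (n + 1),
      ((∏ c, y (h c) c) * (Matrix.of fun c a => x (g c) a).det) *
        MvPolynomial.coeff t (∏ c, DD K (g c) (h c)) := by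
  rw [BB_expand]
  simp only [MvPolynomial.coeff_sum, MvPolynomial.coeff_C_mul]

lemma forward_BB {K : Type*} [Field K] (h2 : (2 : K) ≠ 0) {n r : ℕ}
    (x y : Fin (n + 1) → Fin r → K)
    (i j : Fin r → Fin (n + 1)) (hij : ∀ ν, i ν ≠ j ν) (k : Fin (n + 1))
    (hk : 2 < (Finset.univ.filter fun ν => i ν = k).card
          + (Finset.univ.filter fun ν => j ν = k).card) :
    MvPolynomial.coeff (∑ ν : Fin r, Finsupp.single
          (⟨s(i ν, j ν), by simpa [Sym2.mk_isDiag_iff] using hij ν⟩ :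
            {p : Sym2 (Fin (n + 1)) // ¬ p.IsDiag}) 1) (BB x y) = 0 := by
  rw [coeff_BB]
  refine Finset.sum_eq_zero fun h _ => ?_
  by_cases hh : ∃ c c', c ≠ c' ∧ h c = h c'
  · obtain ⟨c, c', hcc, hc⟩ := hh
    have hsw : ∀ a, h (Equiv.swap c c' a) = h a := by
      intro a
      rcases eq_or_ne a c with rfl | h1
      · rw [Equiv.swap_apply_left, hc]
      · rcases eq_or_ne a c' with rfl | h3
        · rw [Equiv.swap_apply_right, hc]
        · rw [Equiv.swap_apply_of_ne_of_ne h1 h3]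
    set F : (Fin r → Fin (n + 1)) → K := fun g =>
      ((∏ c, y (h c) c) * (Matrix.of fun c a => x (g c) a).det) *
        MvPolynomial.coeff (∑ ν : Fin r, Finsupp.single
          (⟨s(i ν, j ν), by simpa [Sym2.mk_isDiag_iff] using hij ν⟩ :
            {p : Sym2 (Fin (n + 1)) // ¬ p.IsDiag}) 1) (∏ c, DD K (g c) (h c)) with hF
    have hneg : ∀ g, F (g ∘ Equiv.swap c c') = - F g := by
      intro g
      have e1 : (Matrix.of fun b a => x ((g ∘ Equiv.swap c c') b) a).det
          = - (Matrix.of fun c a => x (g c) a).det := by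
        have := Matrix.det_permute (Equiv.swap c c') (Matrix.of fun c a => x (g c) a)
        rw [Equiv.Perm.sign_swap hcc] at this
        simp only [Units.val_neg, Units.val_one, Int.cast_neg, Int.cast_one, neg_mul, one_mul] at this
        exact this
      have e2 : ∏ b, DD K ((g ∘ Equiv.swap c c') b) (h b) = ∏ c, DD K (g c) (h c) := by
        rw [← Equiv.prod_comp (Equiv.swap c c') (fun c => DD K (g c) (h c))]
        simp only [hsw, Function.comp]
      simp only [hF, e1, e2]
      ring
    have : ∑ g, F g = - ∑ g, F g := by
      rw [← Finset.sum_neg_distrib]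
      simp only [← hneg]
      exact ((Equiv.arrowCongr (Equiv.swap c c').symm (Equiv.refl (Fin (n+1)))).sum_comp F).symm
    have h3 : (2 : K) * ∑ g, F g = 0 := by linear_combination this
    exact (mul_eq_zero.mp h3).resolve_left h2
  · refine Finset.sum_eq_zero fun g _ => ?_
    by_contra hne
    have hT := right_ne_zero_of_mul hne
    have hdet := right_ne_zero_of_mul (left_ne_zero_of_mul hne)
    obtain ⟨hgh, ht, -⟩ := coeff_prod_DD g h _ hT
    have e := congrArg (Finsupp.liftAddHom
      (fun e : {p : Sym2 (Fin (n + 1)) // ¬ p.IsDiag} =>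
      if k ∈ e.1 then AddMonoidHom.id ℕ else 0)) ht
    rw [card_of_sum_single i j hij, card_of_sum_single g h hgh] at e
    have hh1 : (Finset.univ.filter fun ν => h ν = k).card ≤ 1 := by
      rw [Finset.card_le_one]
      intro a ha b hb
      by_contra hab
      simp only [Finset.mem_filter, Finset.mem_univ, true_and] at ha hb
      exact hh ⟨a, b, hab, ha.trans hb.symm⟩
    have hg1 : 1 < (Finset.univ.filter fun ν => g ν = k).card := by omega
    rw [Finset.one_lt_card] at hg1
    obtain ⟨a, ha, b, hb, hab⟩ := hg1
    simp only [Finset.mem_filter, Finset.mem_univ, true_and] at ha hb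
    apply hdet
    refine Matrix.det_zero_of_row_eq hab ?_
    ext c
    simp [ha, hb]

lemma degree_sum_single {α : Type*} {r : ℕ} (e : Fin r → α) :
    (∑ c, (Finsupp.single (e c) 1 : α →₀ ℕ)).degree = r := by
  simp [map_sum]

lemma coeff_mul_homog {σ K : Type*} [Field K] {r : ℕ} (t : σ →₀ ℕ) (ht : t.degree = r)
    (q m : MvPolynomial σ K) (hm : m.IsHomogeneous r) (h0 : MvPolynomial.coeff t m = 0) :
    MvPolynomial.coeff t (q * m) = 0 := by
  classical
  rw [MvPolynomial.coeff_mul]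
  refine Finset.sum_eq_zero fun ⟨a, b⟩ hab => ?_
  rw [Finset.HasAntidiagonal.mem_antidiagonal] at hab
  by_contra hne
  have hb := right_ne_zero_of_mul hne
  have hd : b.degree = r := by
    by_contra h
    exact hb (hm.coeff_eq_zero h)
  have : a.degree = 0 := by
    have := congrArg Finsupp.degree hab
    simp only [map_add] at this
    omega
  rw [Finsupp.degree_eq_zero_iff] at this
  simp only at hab hb
  rw [this, zero_add] at hab
  rw [hab] at hb
  exact hb h0

lemma forward {K : Type*} [Field K] (h2 : (2 : K) ≠ 0) {n r : ℕ}
    (i j : Fin r → Fin (n + 1)) (hij : ∀ ν, i ν ≠ j ν) (k : Fin (n + 1))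
    (hk : 2 < (Finset.univ.filter fun ν => i ν = k).card
          + (Finset.univ.filter fun ν => j ν = k).card)
    (p : MvPolynomial {p : Sym2 (Fin (n + 1)) // ¬ p.IsDiag} K)
    (hp : p ∈ Ideal.span {q | ∃ rows cols : Fin r → Fin n,
        q = ((Dmatrix K n).submatrix rows cols).det}) :
    MvPolynomial.coeff (∑ ν : Fin r, Finsupp.single
          (⟨s(i ν, j ν), by simpa [Sym2.mk_isDiag_iff] using hij ν⟩ :
            {p : Sym2 (Fin (n + 1)) // ¬ p.IsDiag}) 1) p = 0 := by
  suffices H : ∀ q, MvPolynomial.coeff (∑ ν : Fin r, Finsupp.single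
          (⟨s(i ν, j ν), by simpa [Sym2.mk_isDiag_iff] using hij ν⟩ :
            {p : Sym2 (Fin (n + 1)) // ¬ p.IsDiag}) 1) (q * p) = 0 by
    simpa using H 1
  induction hp using Submodule.span_induction with
  | mem m hm =>
    obtain ⟨rows, cols, rfl⟩ := hm
    intro q
    rw [minor_eq]
    exact coeff_mul_homog _ (degree_sum_single _) _ _ (BB_homog _ _)
      (forward_BB h2 _ _ i j hij k hk)
  | zero => simp
  | add a b _ _ ha hb => intro q; rw [mul_add, MvPolynomial.coeff_add, ha, hb, add_zero]
  | smul a b _ hb => intro q; rw [smul_eq_mul, ← mul_assoc]; exact hb _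

/-- signed count over orientations -/
def MD {K V : Type*} [Field K] {r : ℕ} (i j : Fin r → V) (x : V → Fin r → K) : K :=
  ∑ o : Fin r → Bool, (Matrix.of fun ν a => x (if o ν then i ν else j ν) a).det *
    (Matrix.of fun ν a => x (if o ν then j ν else i ν) a).det

lemma MD_expand {K V : Type*} [Field K] {r : ℕ} (i j : Fin r → V) (x : V → Fin r → K) :
    MD i j x = ∑ σ : Equiv.Perm (Fin r), ∑ o : Fin r → Bool,
      (∏ c, x (if o (σ c) then j (σ c) else i (σ c)) c) *
        (Matrix.of fun c a => x (if o (σ c) then i (σ c) else j (σ c)) a).det := by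
  unfold MD
  rw [Finset.sum_comm]
  refine Finset.sum_congr rfl fun o _ => ?_
  rw [Matrix.det_apply' (Matrix.of fun ν a => x (if o ν then j ν else i ν) a), Finset.mul_sum]
  refine Finset.sum_congr rfl fun σ _ => ?_
  have := Matrix.det_permute σ (Matrix.of fun ν a => x (if o ν then i ν else j ν) a)
  have h2 : (Matrix.of fun c a => x (if o (σ c) then i (σ c) else j (σ c)) a).det =
    (Equiv.Perm.sign σ : K) * (Matrix.of fun ν a => x (if o ν then i ν else j ν) a).det := this
  rw [h2]
  simp only [Matrix.of_apply]
  ring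

lemma sum_orient {K V : Type*} [Field K] [Fintype V] [DecidableEq V] {r : ℕ} (i j : Fin r → V)
    (hij : ∀ c, i c ≠ j c) (G : (Fin r → V) → (Fin r → V) → K) :
    ∑ o : Fin r → Bool, G (fun c => if o c then i c else j c) (fun c => if o c then j c else i c)
     = ∑ h : Fin r → V, ∑ g : Fin r → V, G g h * if (∀ c, s(g c, h c) = s(i c, j c)) then 1 else 0 := by
  classical
  rw [Finset.sum_comm, ← Fintype.sum_prod_type']
  simp only [mul_ite, mul_one, mul_zero]
  rw [← Finset.sum_filter]
  refine Finset.sum_bij (fun o _ => ((fun c => if o c then i c else j c),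
    (fun c => if o c then j c else i c))) ?_ ?_ ?_ ?_
  · intro o _
    simp only [Finset.mem_filter, Finset.mem_univ, true_and]
    intro c
    cases o c <;> simp [Sym2.eq_swap]
  · intro o _ o' _ hoo
    funext c
    have := congrFun (Prod.ext_iff.mp hoo).1 c
    have h1 := hij c
    simp only at this
    cases h : o c <;> cases h' : o' c <;> simp_all
  · rintro ⟨g, h⟩ hgh
    simp only [Finset.mem_filter, Finset.mem_univ, true_and] at hgh
    refine ⟨fun c => decide (g c = i c), Finset.mem_univ _, ?_⟩
    ext c
    · have := hgh c
      have h1 := hij c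
      rw [Sym2.eq_iff] at this
      rcases this with ⟨h3, h4⟩ | ⟨h3, h4⟩ <;> simp [h3, h1.symm]
    · have := hgh c
      have h1 := hij c
      rw [Sym2.eq_iff] at this
      rcases this with ⟨h3, h4⟩ | ⟨h3, h4⟩ <;> simp [h3, h4, h1.symm]
  · intro o _; rfl

lemma count_perm {K : Type*} [Field K] {n r : ℕ}
    (i j g h : Fin r → Fin (n + 1)) (hij : ∀ ν, i ν ≠ j ν) :
    (∑ σ : Equiv.Perm (Fin r), if (∀ c, s(g c, h c) = s(i (σ c), j (σ c))) then (1 : K) else 0) =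
    (∑ σ : Equiv.Perm (Fin r), if (∀ c, s(i c, j c) = s(i (σ c), j (σ c))) then (1 : K) else 0) *
    MvPolynomial.coeff (∑ ν : Fin r, Finsupp.single
          (⟨s(i ν, j ν), by simpa [Sym2.mk_isDiag_iff] using hij ν⟩ :
            {p : Sym2 (Fin (n + 1)) // ¬ p.IsDiag}) 1) (∏ c, DD K (g c) (h c)) := by
  by_cases hT : MvPolynomial.coeff (∑ ν : Fin r, Finsupp.single
          (⟨s(i ν, j ν), by simpa [Sym2.mk_isDiag_iff] using hij ν⟩ :
            {p : Sym2 (Fin (n + 1)) // ¬ p.IsDiag}) 1) (∏ c, DD K (g c) (h c)) = 0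
  · rw [hT, mul_zero]
    refine Finset.sum_eq_zero fun σ _ => if_neg fun hσ => ?_
    have hgh : ∀ c, g c ≠ h c := by
      intro c hc
      have h1 := hσ c
      have h3 := hij (σ c)
      rw [hc, Sym2.eq_iff] at h1
      rcases h1 with ⟨h4, h5⟩ | ⟨h4, h5⟩
      · exact h3 (h4.symm.trans h5)
      · exact h3 (h5.symm.trans h4)
    have := coeff_prod_DD_of (K := K) g h hgh
    apply one_ne_zero (α := K)
    rw [← this, ← hT]
    congr 1
    rw [← Equiv.sum_comp σ (fun ν => Finsupp.single
          (⟨s(i ν, j ν), by simpa [Sym2.mk_isDiag_iff] using hij ν⟩ :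
            {p : Sym2 (Fin (n + 1)) // ¬ p.IsDiag}) 1)]
    refine Finset.sum_congr rfl fun c _ => ?_
    congr 1
    exact Subtype.ext (hσ c)
  · obtain ⟨hgh, ht, h1⟩ := coeff_prod_DD g h _ hT
    rw [h1, mul_one]
    obtain ⟨τ, hτ⟩ := exists_perm_of_sum_single _ _ ht
    have hτ' : ∀ c, s(g c, h c) = s(i (τ c), j (τ c)) := fun c => congrArg Subtype.val (hτ c)
    rw [← Equiv.sum_comp (Equiv.mulRight τ)]
    refine Finset.sum_congr rfl fun σ _ => ?_
    congr 1
    simp only [hτ', Equiv.coe_mulRight, Equiv.Perm.mul_apply, eq_iff_iff]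
    constructor
    · intro H c
      simpa using H (τ.symm c)
    · intro H c
      exact H _

lemma coeff_of_MD {K : Type*} [Field K] {n r : ℕ}
    (i j : Fin r → Fin (n + 1)) (hij : ∀ ν, i ν ≠ j ν) (x : Fin (n + 1) → Fin r → K)
    (h : MD i j x ≠ 0) :
    MvPolynomial.coeff (∑ ν : Fin r, Finsupp.single
          (⟨s(i ν, j ν), by simpa [Sym2.mk_isDiag_iff] using hij ν⟩ :
            {p : Sym2 (Fin (n + 1)) // ¬ p.IsDiag}) 1) (BB x x) ≠ 0 := by
  have key : MD i j x =
    (∑ σ : Equiv.Perm (Fin r), if (∀ c, s(i c, j c) = s(i (σ c), j (σ c))) then (1 : K) else 0) *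
    MvPolynomial.coeff (∑ ν : Fin r, Finsupp.single
          (⟨s(i ν, j ν), by simpa [Sym2.mk_isDiag_iff] using hij ν⟩ :
            {p : Sym2 (Fin (n + 1)) // ¬ p.IsDiag}) 1) (BB x x) := by
    rw [coeff_BB, MD_expand, Finset.mul_sum]
    have : ∀ σ : Equiv.Perm (Fin r), ∑ o : Fin r → Bool,
      (∏ c, x (if o (σ c) then j (σ c) else i (σ c)) c) *
        (Matrix.of fun c a => x (if o (σ c) then i (σ c) else j (σ c)) a).det =
        ∑ h : Fin r → Fin (n + 1), ∑ g : Fin r → Fin (n + 1),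
          ((∏ c, x (h c) c) * (Matrix.of fun c a => x (g c) a).det) *
          if (∀ c, s(g c, h c) = s(i (σ c), j (σ c))) then 1 else 0 := by
      intro σ
      rw [← sum_orient (fun c => i (σ c)) (fun c => j (σ c)) (fun c => hij _)
        (fun g h => (∏ c, x (h c) c) * (Matrix.of fun c a => x (g c) a).det)]
      exact (Equiv.arrowCongr σ.symm (Equiv.refl Bool)).sum_comp (fun o =>
        (∏ c, x (if o c then j (σ c) else i (σ c)) c) *
        (Matrix.of fun c a => x (if o c then i (σ c) else j (σ c)) a).det)
    simp only [this]
    rw [Finset.sum_comm]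
    refine Finset.sum_congr rfl fun h _ => ?_
    rw [Finset.sum_comm, Finset.mul_sum]
    refine Finset.sum_congr rfl fun g _ => ?_
    rw [← Finset.mul_sum, count_perm i j g h hij]
    ring
  rw [key] at h
  exact right_ne_zero_of_mul h

/-- determinant of a family of vectors -/
def DT {K V : Type*} [Field K] {r : ℕ} (x : V → Fin r → K) (p : Fin r → V) : K :=
  (Matrix.of fun ν a => x (p ν) a).det

/-- truncation of vectors -/
def trv {K V : Type*} {r : ℕ} (x : V → Fin (r + 1) → K) : V → Fin r → K :=
  fun k a => x k a.succ

lemma MD_eq {K V : Type*} [Field K] {r : ℕ} (i j : Fin r → V) (x : V → Fin r → K) :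
    MD i j x = ∑ o : Fin r → Bool, DT x (fun ν => if o ν then i ν else j ν) *
      DT x (fun ν => if o ν then j ν else i ν) := rfl

lemma DT_row {K V : Type*} [Field K] {r : ℕ} (x : V → Fin (r + 1) → K) (v : V) (p : Fin r → V)
    (hv : ∀ a : Fin r, x v a.succ = 0) :
    DT x (Fin.cons v p) = x v 0 * DT (trv x) p := by
  unfold DT
  rw [Matrix.det_succ_row_zero, Fin.sum_univ_succ]
  simp only [Matrix.of_apply, Fin.cons_zero, hv]
  simp
  left; rfl

lemma DT_col {K V : Type*} [Field K] {r : ℕ} (x : V → Fin (r + 1) → K) (v : V) (p : Fin r → V)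
    (hv : ∀ a : Fin r, x (p a) 0 = 0) :
    DT x (Fin.cons v p) = x v 0 * DT (trv x) p := by
  unfold DT
  rw [Matrix.det_succ_column_zero, Fin.sum_univ_succ]
  simp only [Matrix.of_apply, Fin.cons_succ, hv]
  simp
  left; rfl

lemma DT_swap {K V : Type*} [Field K] {r : ℕ} (x : V → Fin (r + 2) → K) (v w : V)
    (p : Fin r → V) :
    DT x (Fin.cons v (Fin.cons w p)) = - DT x (Fin.cons w (Fin.cons v p)) := by
  have := Matrix.det_permute (Equiv.swap (0 : Fin (r + 2)) 1)
    (Matrix.of fun ν a => x ((Fin.cons w (Fin.cons v p) : Fin (r + 2) → V) ν) a)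
  rw [Equiv.Perm.sign_swap (by simp)] at this
  simp only [Units.val_neg, Units.val_one, Int.cast_neg, Int.cast_one, neg_mul, one_mul] at this
  unfold DT
  rw [← this]
  congr 1
  ext ν a
  simp only [Matrix.of_apply, Matrix.submatrix_apply, id]
  congr 1
  refine Fin.cases ?_ (fun ν => Fin.cases ?_ (fun ν => ?_) ν) ν
  · rw [Equiv.swap_apply_left]; rfl
  · have : (Fin.succ 0 : Fin (r + 2)) = 1 := rfl
    rw [this, Equiv.swap_apply_right]; rfl
  · rw [Equiv.swap_apply_of_ne_of_ne (Fin.succ_ne_zero _)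
      (by simp [Fin.ext_iff])]
    rfl

lemma DT_eq_zero {K V : Type*} [Field K] {r : ℕ} (x : V → Fin (r + 2) → K) (v : V)
    (p : Fin r → V) :
    DT x (Fin.cons v (Fin.cons v p)) = 0 := by
  unfold DT
  refine Matrix.det_zero_of_row_eq (i := 0) (j := 1) (by simp) ?_
  rfl

lemma cons_ite {V : Type*} {r : ℕ} (b : Bool) (o : Fin r → Bool) (i j : Fin (r + 1) → V) :
    (fun ν => if (Fin.cons b o : Fin (r + 1) → Bool) ν then i ν else j ν) =
    Fin.cons (if b then i 0 else j 0) (fun ν => if o ν then Fin.tail i ν else Fin.tail j ν) := by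
  funext ν
  refine Fin.cases ?_ (fun ν => ?_) ν
  · simp
  · simp [Fin.tail]

lemma MD_succ {K V : Type*} [Field K] {r : ℕ} (i j : Fin (r + 1) → V) (x : V → Fin (r + 1) → K) :
    MD i j x = ∑ o : Fin r → Bool,
      (DT x (Fin.cons (i 0) (fun ν => if o ν then Fin.tail i ν else Fin.tail j ν)) *
       DT x (Fin.cons (j 0) (fun ν => if o ν then Fin.tail j ν else Fin.tail i ν)) +
       DT x (Fin.cons (j 0) (fun ν => if o ν then Fin.tail i ν else Fin.tail j ν)) *
       DT x (Fin.cons (i 0) (fun ν => if o ν then Fin.tail j ν else Fin.tail i ν))) := by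
  rw [MD_eq, ← (Fin.consEquiv (fun _ => Bool)).sum_comp, Fintype.sum_prod_type, Fintype.sum_bool,
    ← Finset.sum_add_distrib]
  refine Finset.sum_congr rfl fun o _ => ?_
  simp only [Fin.consEquiv_apply, cons_ite]
  simp

lemma MD_loop {K V : Type*} [Field K] {r : ℕ} (i j : Fin (r + 1) → V) (x : V → Fin (r + 1) → K)
    (v : V) (hi : i 0 = v) (hj : j 0 = v) (h1 : x v 0 = 1) (h0 : ∀ a : Fin r, x v a.succ = 0) :
    MD i j x = 2 * MD (Fin.tail i) (Fin.tail j) (trv x) := by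
  rw [MD_succ, MD_eq, Finset.mul_sum]
  refine Finset.sum_congr rfl fun o _ => ?_
  rw [hi, hj, DT_row x v _ h0, DT_row x v _ h0, h1]
  ring

lemma MD_iso {K V : Type*} [Field K] {r : ℕ} (i j : Fin (r + 1) → V) (x : V → Fin (r + 1) → K)
    (h : ∀ ν : Fin r, x (i ν.succ) 0 = 0 ∧ x (j ν.succ) 0 = 0) :
    MD i j x = 2 * x (i 0) 0 * x (j 0) 0 * MD (Fin.tail i) (Fin.tail j) (trv x) := by
  rw [MD_succ, MD_eq, Finset.mul_sum]
  refine Finset.sum_congr rfl fun o _ => ?_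
  have e1 : ∀ ν, x (if o ν then Fin.tail i ν else Fin.tail j ν) 0 = 0 := by
    intro ν; split_ifs
    · exact (h ν).1
    · exact (h ν).2
  have e2 : ∀ ν, x (if o ν then Fin.tail j ν else Fin.tail i ν) 0 = 0 := by
    intro ν; split_ifs
    · exact (h ν).2
    · exact (h ν).1
  rw [DT_col x (i 0) _ e1, DT_col x (i 0) _ e2, DT_col x (j 0) _ e1, DT_col x (j 0) _ e2]
  ring

lemma MD_splice {K V : Type*} [Field K] {r : ℕ} (i j : Fin (r + 2) → V) (x : V → Fin (r + 2) → K)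
    (v : V) (hj : j 0 = v) (hi : i 1 = v) (h1 : x v 0 = 1)
    (h0 : ∀ a : Fin (r + 1), x v a.succ = 0) :
    MD i j x = - MD (Fin.cons (i 0) (Fin.tail (Fin.tail i)))
      (Fin.cons (j 1) (Fin.tail (Fin.tail j))) (trv x) := by
  rw [MD_succ, ← (Fin.consEquiv (fun _ => Bool)).sum_comp, Fintype.sum_prod_type, Fintype.sum_bool,
    ← Finset.sum_add_distrib, MD_succ, ← Finset.sum_neg_distrib]
  refine Finset.sum_congr rfl fun o _ => ?_
  simp only [Fin.consEquiv_apply, cons_ite]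
  have hi' : Fin.tail i 0 = v := hi
  have hj' : Fin.tail j 0 = j 1 := rfl
  simp only [if_true, Bool.false_eq_true, if_false, hi', hj', hj, Fin.cons_zero, Fin.tail_cons,
    DT_eq_zero]
  simp only [DT_swap x (i 0) v, DT_row x v _ h0, h1]
  ring

lemma MD_congr {K V : Type*} [Field K] {r : ℕ} (i j : Fin r → V) (x y : V → Fin r → K)
    (h : ∀ ν, x (i ν) = y (i ν) ∧ x (j ν) = y (j ν)) : MD i j x = MD i j y := by
  unfold MD
  have e1 : ∀ (o : Fin r → Bool) ν, x (if o ν then i ν else j ν) = y (if o ν then i ν else j ν) := by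
    intro o ν; split_ifs
    · exact (h ν).1
    · exact (h ν).2
  have e2 : ∀ (o : Fin r → Bool) ν, x (if o ν then j ν else i ν) = y (if o ν then j ν else i ν) := by
    intro o ν; split_ifs
    · exact (h ν).2
    · exact (h ν).1
  simp only [e1, e2]

lemma MD_perm {K V : Type*} [Field K] {r : ℕ} (i j : Fin r → V) (x : V → Fin r → K)
    (σ : Equiv.Perm (Fin r)) : MD (i ∘ σ) (j ∘ σ) x = MD i j x := by
  rw [MD_eq, MD_eq, ← (Equiv.arrowCongr σ.symm (Equiv.refl Bool)).sum_comp]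
  refine Finset.sum_congr rfl fun o _ => ?_
  have h : ∀ p : Fin r → V, DT x (p ∘ σ) = (Equiv.Perm.sign σ : K) * DT x p := fun p =>
    Matrix.det_permute σ (Matrix.of fun ν a => x (p ν) a)
  have e1 := h (fun ν => if o ν then i ν else j ν)
  have e2 := h (fun ν => if o ν then j ν else i ν)
  have hs : (Equiv.Perm.sign σ : K) * (Equiv.Perm.sign σ : K) = 1 := by
    rcases Int.units_eq_one_or (Equiv.Perm.sign σ) with h | h <;> simp [h]
  have := congrArg₂ (· * ·) e1 e2
  refine Eq.trans this ?_
  linear_combination (DT x fun ν => if o ν then i ν else j ν) *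
    (DT x fun ν => if o ν then j ν else i ν) * hs

lemma MD_flip {K V : Type*} [Field K] {r : ℕ} (i j : Fin r → V) (x : V → Fin r → K)
    (s : Fin r → Bool) :
    MD (fun ν => if s ν then j ν else i ν) (fun ν => if s ν then i ν else j ν) x = MD i j x := by
  rw [MD_eq, MD_eq]
  refine Fintype.sum_bijective (fun o ν => xor (o ν) (s ν)) ?_ _ _ ?_
  · refine Function.Involutive.bijective fun o => ?_
    funext ν
    simp
  · intro o
    congr 2
    · funext ν
      cases h1 : o ν <;> cases h2 : s ν <;> simp [h1, h2]
    · funext ν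
      cases h1 : o ν <;> cases h2 : s ν <;> simp [h1, h2]

/-- incidence count -/
def dg {V : Type*} [DecidableEq V] {r : ℕ} (i j : Fin r → V) (k : V) : ℕ :=
  ∑ ν, ((if i ν = k then 1 else 0) + (if j ν = k then 1 else 0))

lemma dg_succ {V : Type*} [DecidableEq V] {r : ℕ} (i j : Fin (r + 1) → V) (k : V) :
    dg i j k = (if i 0 = k then 1 else 0) + (if j 0 = k then 1 else 0)
      + dg (Fin.tail i) (Fin.tail j) k := by
  unfold dg
  rw [Fin.sum_univ_succ]; rfl

lemma dg_zero {V : Type*} [DecidableEq V] {r : ℕ} (i j : Fin r → V) (k : V)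
    (h : dg i j k = 0) (ν : Fin r) : i ν ≠ k ∧ j ν ≠ k := by
  unfold dg at h
  rw [Finset.sum_eq_zero_iff] at h
  have := h ν (Finset.mem_univ _)
  constructor <;> intro hh <;> simp [hh] at this

/-- the target of the induction -/
def Good (K : Type*) {V : Type*} [Field K] [DecidableEq V] (S : Finset V) {r : ℕ}
    (i j : Fin r → V) : Prop :=
  ∃ x : V → Fin r → K, ∑ k ∈ S, x k = 0 ∧ MD i j x ≠ 0

/-- hypotheses of the induction -/
def Hyp {V : Type*} [DecidableEq V] (S : Finset V) {r : ℕ}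
    (i j : Fin r → V) : Prop :=
  (∀ ν, i ν ∈ S ∧ j ν ∈ S) ∧ (∀ k, dg i j k ≤ 2) ∧ r < S.card

lemma Hyp_perm {V : Type*} [DecidableEq V] (S : Finset V) {r : ℕ}
    (i j : Fin r → V) (σ : Equiv.Perm (Fin r)) (h : Hyp S i j) : Hyp S (i ∘ σ) (j ∘ σ) := by
  refine ⟨fun ν => h.1 _, fun k => ?_, h.2.2⟩
  refine le_trans (le_of_eq ?_) (h.2.1 k)
  exact Equiv.sum_comp σ (fun ν => ((if i ν = k then 1 else 0) + (if j ν = k then 1 else 0)))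

lemma Hyp_flip {V : Type*} [DecidableEq V] (S : Finset V) {r : ℕ}
    (i j : Fin r → V) (s : Fin r → Bool) (h : Hyp S i j) :
    Hyp S (fun ν => if s ν then j ν else i ν) (fun ν => if s ν then i ν else j ν) := by
  refine ⟨fun ν => ?_, fun k => ?_, h.2.2⟩
  · have := h.1 ν
    cases h1 : s ν <;> simp [h1, this]
  · refine le_trans (le_of_eq ?_) (h.2.1 k)
    refine Finset.sum_congr rfl fun ν _ => ?_
    cases h1 : s ν <;> simp [h1, add_comm]

/-- extension of vectors by a new basis vector at `v` -/
def extv {K V : Type*} [Field K] [DecidableEq V] {r : ℕ} (v w : V) (x : V → Fin r → K) :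
    V → Fin (r + 1) → K :=
  fun k => if k = v then Fin.cons 1 0 else Fin.cons (if k = w then -1 else 0) (x k)

lemma extv_sum {K V : Type*} [Field K] [DecidableEq V] {r : ℕ} (S : Finset V) (v w : V)
    (hv : v ∈ S) (hw : w ∈ S.erase v)
    (x : V → Fin r → K) (hx : ∑ k ∈ S.erase v, x k = 0) : ∑ k ∈ S, extv v w x k = 0 := by
  rw [← Finset.add_sum_erase S _ hv]
  have : ∑ k ∈ S.erase v, extv v w x k =
      ∑ k ∈ S.erase v, (Fin.cons (if k = w then -1 else 0) (x k) : Fin (r + 1) → K) := by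
    refine Finset.sum_congr rfl fun k hk => ?_
    rw [extv, if_neg (Finset.ne_of_mem_erase hk)]
  rw [this]
  ext a
  refine Fin.cases ?_ (fun a => ?_) a
  · simp only [extv, if_true, Pi.add_apply, Finset.sum_apply, Fin.cons_zero, Finset.sum_ite_eq',
      if_pos hw]
    simp
  · have := congrFun hx a
    simp only [Finset.sum_apply] at this
    simp only [extv, if_true, Pi.add_apply, Finset.sum_apply, Fin.cons_succ, this]
    simp

lemma Good_splice {K V : Type*} [Field K] [DecidableEq V] {r : ℕ}
    (S : Finset V) (i j : Fin (r + 2) → V) (H : Hyp S i j) (hji : j 0 = i 1)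
    (ih : ∀ (S : Finset V) (i j : Fin (r + 1) → V), Hyp S i j → Good K S i j) :
    Good K S i j := by
  obtain ⟨hS, hd, hc⟩ := H
  set v := j 0 with hv
  have hvS : v ∈ S := (hS 0).2
  have hexp : ∀ k, dg i j k = (if i 0 = k then 1 else 0) + (if v = k then 1 else 0)
      + ((if v = k then 1 else 0) + (if j 1 = k then 1 else 0)
      + dg (Fin.tail (Fin.tail i)) (Fin.tail (Fin.tail j)) k) := by
    intro k
    rw [dg_succ, dg_succ]
    have e1 : Fin.tail i 0 = v := hji.symm
    have e2 : Fin.tail j 0 = j 1 := rfl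
    rw [e1, e2, ← hv]
  have hv2 := hd v
  rw [hexp v, if_pos rfl] at hv2
  have hi0 : i 0 ≠ v := by intro h; rw [if_pos h] at hv2; omega
  have hj1 : j 1 ≠ v := by intro h; rw [if_pos h] at hv2; omega
  have hdz : dg (Fin.tail (Fin.tail i)) (Fin.tail (Fin.tail j)) v = 0 := by omega
  have hav := dg_zero _ _ _ hdz
  have hcard : (S.erase v).card = S.card - 1 := Finset.card_erase_of_mem hvS
  obtain ⟨x, hx, hMD⟩ := ih (S.erase v) (Fin.cons (i 0) (Fin.tail (Fin.tail i)))
      (Fin.cons (j 1) (Fin.tail (Fin.tail j))) ⟨by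
        intro ν
        refine Fin.cases ?_ (fun ν => ?_) ν
        · simp [hi0, hj1, (hS 0).1, (hS 1).2]
        · simp only [Fin.cons_succ, Finset.mem_erase]
          exact ⟨⟨(hav ν).1, (hS _).1⟩, ⟨(hav ν).2, (hS _).2⟩⟩, by
        intro k
        have := hd k
        rw [hexp k] at this
        rw [dg_succ]
        simp only [Fin.cons_zero, Fin.tail_cons]
        omega, by omega⟩
  have hne : (S.erase v).Nonempty := by rw [← Finset.card_pos]; omega
  obtain ⟨w, hw⟩ := hne
  refine ⟨extv v w x, extv_sum S v w hvS hw x hx, ?_⟩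
  rw [MD_splice i j _ v hv.symm hji.symm (by simp [extv]) (by simp [extv]), neg_ne_zero]
  rw [MD_congr _ _ _ x]
  · exact hMD
  · intro ν
    refine Fin.cases ?_ (fun ν => ?_) ν
    · constructor <;> (ext a; simp [trv, extv, hi0, hj1])
    · constructor <;> (ext a; simp [trv, extv, hav ν])

lemma Good_share {K V : Type*} [Field K] [DecidableEq V] {r : ℕ}
    (S : Finset V) (i j : Fin (r + 2) → V) (H : Hyp S i j)
    (hsh : i 0 = i 1 ∨ i 0 = j 1 ∨ j 0 = i 1 ∨ j 0 = j 1)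
    (ih : ∀ (S : Finset V) (i j : Fin (r + 1) → V), Hyp S i j → Good K S i j) :
    Good K S i j := by
  have key : ∀ s : Fin (r + 2) → Bool, (if s 0 then i 0 else j 0) = (if s 1 then j 1 else i 1) →
      Good K S i j := by
    intro s hs
    obtain ⟨x, hx, hM⟩ := Good_splice S _ _ (Hyp_flip S i j s H) hs ih
    exact ⟨x, hx, by rwa [MD_flip] at hM⟩
  rcases hsh with h | h | h | h
  · exact key (Fin.cons true (fun _ => false)) h
  · exact key (fun _ => true) h
  · exact key (fun _ => false) h
  · exact key (Fin.cons false (fun _ => true)) h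

lemma Good_all {K V : Type*} [Field K] (h2 : (2 : K) ≠ 0) [DecidableEq V] (r : ℕ) :
    ∀ (S : Finset V) (i j : Fin r → V), Hyp S i j → Good K S i j := by
  induction r with
  | zero =>
    intro S i j _
    refine ⟨fun _ => 0, by simp, ?_⟩
    simp [MD]
  | succ r ih =>
    intro S i j H
    by_cases hsh : ∃ ν : Fin r, i 0 = i ν.succ ∨ i 0 = j ν.succ ∨ j 0 = i ν.succ ∨ j 0 = j ν.succ
    · obtain ⟨ν, hν⟩ := hsh
      obtain _ | r := r
      · exact ν.elim0
      · have e0 : Equiv.swap 1 ν.succ (0 : Fin (r + 2)) = 0 :=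
          Equiv.swap_apply_of_ne_of_ne (by simp) (Fin.succ_ne_zero _).symm
        have e1 : Equiv.swap 1 ν.succ (1 : Fin (r + 2)) = ν.succ := Equiv.swap_apply_left _ _
        obtain ⟨x, hx, hM⟩ := Good_share (K := K) S _ _ (Hyp_perm S i j (Equiv.swap 1 ν.succ) H)
          (by simpa only [Function.comp, e0, e1] using hν) ih
        exact ⟨x, hx, by rwa [MD_perm] at hM⟩
    · push Not at hsh
      obtain ⟨hS, hd, hc⟩ := H
      have hcard : (S.erase (j 0)).card = S.card - 1 := Finset.card_erase_of_mem (hS 0).2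
      obtain ⟨x, hx, hMD⟩ := ih (S.erase (j 0)) (Fin.tail i) (Fin.tail j) ⟨by
          intro ν
          have := hsh ν
          simp only [Finset.mem_erase]
          exact ⟨⟨this.2.2.1.symm, (hS _).1⟩, ⟨this.2.2.2.symm, (hS _).2⟩⟩, by
          intro k
          have := hd k
          rw [dg_succ] at this
          omega, by omega⟩
      by_cases hl : i 0 = j 0
      · have hne : (S.erase (j 0)).Nonempty := by rw [← Finset.card_pos]; omega
        obtain ⟨w, hw⟩ := hne
        refine ⟨extv (j 0) w x, extv_sum S _ w (hS 0).2 hw x hx, ?_⟩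
        rw [MD_loop i j _ (j 0) hl rfl (by simp [extv]) (by simp [extv])]
        refine mul_ne_zero h2 ?_
        rw [MD_congr _ _ _ x]
        · exact hMD
        · intro ν
          have := hsh ν
          constructor <;>
          (ext a; simp [trv, extv, Fin.tail, this.2.2.1.symm, this.2.2.2.symm])
      · let y : V → Fin (r + 1) → K := fun k => if k = j 0 then Fin.cons (-1) 0 else
          Fin.cons (if k = i 0 then 1 else 0) (x k)
        refine ⟨y, ?_, ?_⟩
        · rw [← Finset.add_sum_erase S _ (hS 0).2]
          have : ∑ k ∈ S.erase (j 0), y k =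
              ∑ k ∈ S.erase (j 0), (Fin.cons (if k = i 0 then 1 else 0) (x k) : Fin (r + 1) → K) := by
            refine Finset.sum_congr rfl fun k hk => ?_
            simp only [y]
            rw [if_neg (Finset.ne_of_mem_erase hk)]
          rw [this]
          have hw : i 0 ∈ S.erase (j 0) := Finset.mem_erase.mpr ⟨hl, (hS 0).1⟩
          ext a
          refine Fin.cases ?_ (fun a => ?_) a
          · simp only [y, if_true, Pi.add_apply, Finset.sum_apply, Fin.cons_zero,
              Finset.sum_ite_eq', if_pos hw]
            simp
          · have := congrFun hx a
            simp only [Finset.sum_apply] at this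
            simp only [y, if_true, Pi.add_apply, Finset.sum_apply, Fin.cons_succ, this]
            simp
        · rw [MD_iso i j y]
          · have e1 : y (i 0) 0 = 1 := by simp [y, hl]
            have e2 : y (j 0) 0 = -1 := by simp [y]
            rw [e1, e2, MD_congr _ _ _ x]
            · refine mul_ne_zero ?_ hMD
              simpa using h2
            · intro ν
              have := hsh ν
              constructor <;>
              (ext a; simp [trv, y, Fin.tail, this.2.2.1.symm, this.2.2.2.symm])
          · intro ν
            have := hsh ν
            simp [y, this.1.symm, this.2.1.symm, this.2.2.1.symm, this.2.2.2.symm]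

theorem stmt16 {K : Type*} [Field K] (h2 : (2 : K) ≠ 0) {n : ℕ}
    {r : ℕ} (hr1 : 1 ≤ r) (hrn : r ≤ n)
    (I : Ideal (MvPolynomial {p : Sym2 (Fin (n + 1)) // ¬ p.IsDiag} K))
    (hI : I = Ideal.span {q | ∃ rows cols : Fin r → Fin n,
        q = ((Dmatrix K n).submatrix rows cols).det})
    (i j : Fin r → Fin (n + 1)) (hij : ∀ ν, i ν ≠ j ν) :
    ((∃ p ∈ I, MvPolynomial.coeff
        (∑ ν : Fin r, Finsupp.single
          (⟨s(i ν, j ν), by simpa [Sym2.mk_isDiag_iff] using hij ν⟩ :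
            {p : Sym2 (Fin (n + 1)) // ¬ p.IsDiag}) 1) p ≠ 0) ↔
      ∀ k : Fin (n + 1),
        (Finset.univ.filter fun ν => i ν = k).card
          + (Finset.univ.filter fun ν => j ν = k).card ≤ 2) := by
  subst hI
  constructor
  · rintro ⟨p, hp, hne⟩ k
    by_contra hk
    exact hne (forward h2 i j hij k (by omega) p hp)
  · intro h
    obtain ⟨x, hx, hM⟩ := Good_all (K := K) h2 r Finset.univ i j ⟨by simp, fun k => by
      have := h k
      rw [Finset.card_filter, Finset.card_filter, ← Finset.sum_add_distrib] at this
      exact this, by simpa using Nat.lt_succ_of_le hrn⟩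
    exact ⟨BB x x, BB_mem x x hx hx, coeff_of_MD i j hij x hM⟩
end

section
/- Let K be a field, n > m >= 1, and let I be the ideal of relations among the signed volumes: I is the kernel of the map from the polynomial ring in indeterminates A_{i_0...i_m} (1 <= i_0 < ... < i_m <= n) to K[x_{1,1},...,x_{n,m}] sending A_{i_0...i_m} to det(x_{i_j,k} - x_{i_0,k})_{j,k=1..m}. If l is a nonzero linear combination of at most m+2 of the indeterminates A_{i_0...i_m}, all of whose coefficients are 1 or -1, and l lies in I, then l = sum over k from 0 to m+1 of (-1)^k A_{i_0...i_{k-1} i_{k+1}...i_{m+1}} for some pairwise distinct indices i_0,...,i_{m+1} in {1,...,n} (with A with unordered indices interpreted via the alternating sign convention). -/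
/-- Index type: strictly increasing `(m+1)`-tuples in `{1,…,n}`. -/
def VolIdx (n m : ℕ) := {s : Fin (m + 1) → Fin n // StrictMono s}

/-- The map sending the indeterminate `A_{i_0 … i_m}` to the generic signed volume
`det (x_{i_j,k} - x_{i_0,k})_{j,k}`. -/
noncomputable def volMap (K : Type*) [Field K] (n m : ℕ) :
    MvPolynomial (VolIdx n m) K →ₐ[K] MvPolynomial (Fin n × Fin m) K :=
  MvPolynomial.aeval fun s =>
    (Matrix.of fun (j k : Fin m) =>
      MvPolynomial.X (s.1 j.succ, k) - MvPolynomial.X (s.1 0, k)).det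

open Finset in
theorem vol_eq_det {R : Type*} [CommRing R] {m : ℕ} (p : Fin (m + 1) → Fin m → R) :
    (Matrix.of fun (j k : Fin m) => p j.succ k - p 0 k).det =
      (Matrix.of fun (i : Fin (m + 1)) => (Fin.cons 1 (p i) : Fin (m + 1) → R)).det := by
  rw [← Matrix.det_eq_of_forall_row_eq_smul_add_const
    (A := Matrix.of fun (i : Fin (m + 1)) (j : Fin (m + 1)) =>
      (Fin.cons 1 (p i) : Fin (m + 1) → R) j - (if i = 0 then 0 else (Fin.cons 1 (p 0) : Fin (m + 1) → R) j))
    (fun i => if i = 0 then 0 else -1) 0 (by simp)]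
  · rw [Matrix.det_succ_column_zero, Fin.sum_univ_succ]
    simp [Matrix.submatrix, Matrix.of_apply]
  · intro i j
    by_cases hi : i = 0
    · simp [hi]
    · simp [hi, sub_eq_add_neg]

theorem vol_boundary {R : Type*} [CommRing R] {m : ℕ} (p : Fin (m + 2) → Fin m → R) :
    ∑ k : Fin (m + 2), (-1) ^ (k : ℕ) *
      (Matrix.of fun (j l : Fin m) => p (k.succAbove j.succ) l - p (k.succAbove 0) l).det = 0 := by
  have h : (Matrix.of fun (i : Fin (m + 2)) =>
      (Fin.cons 1 (Fin.cons 1 (p i) : Fin (m + 1) → R) : Fin (m + 2) → R)).det = 0 := by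
    apply Matrix.det_zero_of_column_eq (i := 0) (j := 1) (by simp)
    intro k
    rfl
  rw [Matrix.det_succ_column_zero] at h
  rw [← h]
  apply Finset.sum_congr rfl
  intro k _
  rw [vol_eq_det (fun i => p (k.succAbove i))]
  simp only [Matrix.of_apply, Fin.cons_zero, mul_one]
  congr 1

/-- volume of a configuration -/
noncomputable def myVol {R : Type*} [CommRing R] {n m : ℕ} (x : Fin n → Fin m → R)
    (s : VolIdx n m) : R :=
  (Matrix.of fun (j k : Fin m) => x (s.1 j.succ) k - x (s.1 0) k).det

theorem volMap_X {K : Type*} [Field K] {n m : ℕ} (s : VolIdx n m) :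
    volMap K n m (MvPolynomial.X s) = myVol (fun i k => MvPolynomial.X (i, k)) s := by
  simp [volMap, myVol]

theorem eval_myVol {K : Type*} [Field K] {n m : ℕ} (x : Fin n → Fin m → K) (s : VolIdx n m) :
    MvPolynomial.eval (fun q : Fin n × Fin m => x q.1 q.2)
      (myVol (fun i k => MvPolynomial.X (i, k)) s) = myVol x s := by
  unfold myVol
  rw [RingHom.map_det]
  congr 1
  ext j k
  simp

/-- the set of vertices -/
def vset {n m : ℕ} (s : VolIdx n m) : Finset (Fin n) := Finset.univ.image s.1

theorem vset_card {n m : ℕ} (s : VolIdx n m) : (vset s).card = m + 1 := by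
  rw [vset, Finset.card_image_of_injective _ s.2.injective]; simp

theorem vset_inj {n m : ℕ} {s t : VolIdx n m} (h : vset s = vset t) : s = t := by
  apply Subtype.ext
  apply (StrictMono.range_inj s.2 t.2).1
  have := congrArg (fun F : Finset (Fin n) => (F : Set (Fin n))) h
  simpa [vset] using this

theorem mem_vset {n m : ℕ} (s : VolIdx n m) (k) : s.1 k ∈ vset s := by simp [vset]

/-- the special configuration for a face -/
noncomputable def conf (K : Type*) [Field K] {n m : ℕ} (f : Fin m → Fin n) : Fin n → Fin m → K :=
  fun v => match Function.partialInv f v with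
    | none => 0
    | some j => Pi.single j 1

theorem conf_face (K : Type*) [Field K] {n m : ℕ} (s : VolIdx n m) (k : Fin (m + 1)) :
    myVol (conf K (fun j => s.1 (k.succAbove j))) s ≠ 0 := by
  have hinj : Function.Injective (fun j => s.1 (k.succAbove j)) :=
    s.2.injective.comp Fin.succAbove_right_injective
  have hp := Function.Injective.isPartialInv hinj
  have h1 : ∀ j, conf K (fun j => s.1 (k.succAbove j)) (s.1 (k.succAbove j)) = Pi.single j 1 := by
    intro j
    have := (hp j (s.1 (k.succAbove j))).2 rfl
    simp only [conf, this]
  have h2 : conf K (fun j => s.1 (k.succAbove j)) (s.1 k) = 0 := by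
    have : Function.partialInv (fun j => s.1 (k.succAbove j)) (s.1 k) = none := by
      rw [Option.eq_none_iff_forall_ne_some]
      intro j hj
      have := (hp j _).1 hj
      exact Fin.succAbove_ne k j (s.2.injective this)
    simp only [conf, this]
  unfold myVol
  rw [vol_eq_det (fun i => conf K (fun j => s.1 (k.succAbove j)) (s.1 i)),
    Matrix.det_succ_row _ k, Fin.sum_univ_succ]
  have h3 : ((Matrix.of fun i : Fin (m + 1) => (Fin.cons 1
      (conf K (fun j => s.1 (k.succAbove j)) (s.1 i)) : Fin (m + 1) → K)).submatrix
      k.succAbove (Fin.succAbove 0)) = 1 := by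
    ext i j
    simp [h1, Matrix.one_apply, Pi.single_apply, eq_comm]
  rw [h3]
  simp [h2]

theorem conf_other (K : Type*) [Field K] {n m : ℕ} (f : Fin m → Fin n)
    (hf : Function.Injective f) (t : VolIdx n m)
    (h : myVol (conf K f) t ≠ 0) (j : Fin m) : f j ∈ vset t := by
  have hp := Function.Injective.isPartialInv hf
  have hi : Function.Injective (fun i => Function.partialInv f (t.1 i)) := by
    intro a b hab
    by_contra hne
    apply h
    unfold myVol
    rw [vol_eq_det (fun i => conf K f (t.1 i))]
    apply Matrix.det_zero_of_row_eq hne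
    ext l
    have : conf K f (t.1 a) = conf K f (t.1 b) := by
      simp only [conf]
      simp only at hab
      rw [hab]
    simp [this]
  have hs : Function.Surjective (fun i => Function.partialInv f (t.1 i)) :=
    ((Fintype.bijective_iff_injective_and_card _).2 ⟨hi, by simp⟩).2
  obtain ⟨i, hi⟩ := hs (some j)
  rw [(hp j _).1 hi]
  exact mem_vset t i

theorem neighbor {K : Type*} [Field K] {n m : ℕ} {ι : Type*} (f : ι → VolIdx n m)
    (S : Finset ι) (c : ι → K)
    (h : volMap K n m (∑ i ∈ S, c i • MvPolynomial.X (f i)) = 0)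
    (i : ι) (hi : i ∈ S) (hc : c i ≠ 0) (k : Fin (m + 1)) :
    ∃ j ∈ S, j ≠ i ∧ c j ≠ 0 ∧ (vset (f i)).erase ((f i).1 k) ⊆ vset (f j) := by
  classical
  by_contra hcon
  push Not at hcon
  set x := conf K (fun j => (f i).1 (k.succAbove j)) with hx
  have h1 : ∑ j ∈ S, c j * myVol x (f j) = 0 := by
    have := congrArg (MvPolynomial.eval (fun q : Fin n × Fin m => x q.1 q.2)) h
    simpa [map_sum, volMap_X, eval_myVol, MvPolynomial.smul_eval] using this
  rw [Finset.sum_eq_single i] at h1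
  · rcases mul_eq_zero.1 h1 with h2 | h2
    · exact hc h2
    · exact conf_face K (f i) k h2
  · intro j hj hji
    by_contra hne
    have hcj := left_ne_zero_of_mul hne
    have hv := right_ne_zero_of_mul hne
    apply hcon j hj hji hcj
    intro v hv'
    rw [Finset.mem_erase] at hv'
    obtain ⟨hv1, hv2⟩ := hv'
    simp only [vset, Finset.mem_image, Finset.mem_univ, true_and] at hv2
    obtain ⟨a, rfl⟩ := hv2
    have hak : a ≠ k := fun e => hv1 (by rw [e])
    obtain ⟨b, rfl⟩ := Fin.exists_succAbove_eq hak
    exact conf_other K _ ((f i).2.injective.comp Fin.succAbove_right_injective) (f j) hv b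
  · intro h; exact absurd hi h

theorem neighbors {K : Type*} [Field K] {n m : ℕ} {ι : Type*} [DecidableEq ι] (f : ι → VolIdx n m)
    (hf : Function.Injective f)
    (S : Finset ι) (c : ι → K) (hc : ∀ i ∈ S, c i ≠ 0)
    (h : volMap K n m (∑ i ∈ S, c i • MvPolynomial.X (f i)) = 0)
    (i : ι) (hi : i ∈ S) :
    ∃ g : Fin (m + 1) → ι, Function.Injective g ∧ (∀ k, g k ∈ S.erase i) ∧
      ∀ k, (vset (f i)).erase ((f i).1 k) ⊆ vset (f (g k)) := by
  choose g hg1 hg2 hg3 hg4 using neighbor f S c h i hi (hc i hi)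
  refine ⟨g, ?_, fun k => Finset.mem_erase.2 ⟨hg2 k, hg1 k⟩, hg4⟩
  intro a b hab
  by_contra hne
  have : vset (f i) ⊆ vset (f (g a)) := by
    intro v hv
    by_cases hva : v = (f i).1 a
    · rw [hab]
      apply hg4
      rw [Finset.mem_erase]
      refine ⟨?_, hv⟩
      rw [hva]
      exact fun e => hne ((f i).2.injective e)
    · exact hg4 a (Finset.mem_erase.2 ⟨hva, hv⟩)
  have := Finset.eq_of_subset_of_card_le this (by rw [vset_card, vset_card])
  exact hg2 a (hf (vset_inj this)).symm

theorem lower_bound {K : Type*} [Field K] {n m : ℕ} {ι : Type*} [DecidableEq ι]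
    (f : ι → VolIdx n m) (hf : Function.Injective f)
    (S : Finset ι) (c : ι → K) (hc : ∀ i ∈ S, c i ≠ 0)
    (h : volMap K n m (∑ i ∈ S, c i • MvPolynomial.X (f i)) = 0)
    (hS : S.Nonempty) : m + 2 ≤ S.card := by
  obtain ⟨i, hi⟩ := hS
  obtain ⟨g, hg, hg1, -⟩ := neighbors f hf S c hc h i hi
  have h1 : (Finset.univ.image g).card ≤ (S.erase i).card := by
    apply Finset.card_le_card
    intro x hx
    obtain ⟨k, -, rfl⟩ := Finset.mem_image.1 hx
    exact hg1 k
  rw [Finset.card_image_of_injective _ hg, Finset.card_erase_of_mem hi] at h1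
  have := Finset.card_pos.2 ⟨i, hi⟩
  simp at h1
  omega

theorem neighbors_surj {K : Type*} [Field K] {n m : ℕ} {ι : Type*} [DecidableEq ι]
    (f : ι → VolIdx n m) (hf : Function.Injective f)
    (S : Finset ι) (c : ι → K) (hc : ∀ i ∈ S, c i ≠ 0)
    (h : volMap K n m (∑ i ∈ S, c i • MvPolynomial.X (f i)) = 0)
    (hS : S.card = m + 2) (i : ι) (hi : i ∈ S) :
    ∃ g : Fin (m + 1) → ι, Function.Injective g ∧ (∀ k, g k ∈ S.erase i) ∧
      (∀ j ∈ S, j ≠ i → ∃ k, g k = j) ∧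
      ∀ k, (vset (f i)).erase ((f i).1 k) ⊆ vset (f (g k)) := by
  obtain ⟨g, hg, hg1, hg2⟩ := neighbors f hf S c hc h i hi
  refine ⟨g, hg, hg1, ?_, hg2⟩
  have h1 : Finset.univ.image g = S.erase i := by
    apply Finset.eq_of_subset_of_card_le
    · intro x hx
      obtain ⟨k, -, rfl⟩ := Finset.mem_image.1 hx
      exact hg1 k
    · rw [Finset.card_image_of_injective _ hg, Finset.card_erase_of_mem hi]
      simp [hS]
  intro j hj hji
  have : j ∈ Finset.univ.image g := by rw [h1]; exact Finset.mem_erase.2 ⟨hji, hj⟩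
  simpa using this

/-- pairwise adjacency -/
theorem inter_card {K : Type*} [Field K] {n m : ℕ}
    [DecidableEq (VolIdx n m)]
    (S : Finset (VolIdx n m)) (c : VolIdx n m → K) (hc : ∀ i ∈ S, c i ≠ 0)
    (h : volMap K n m (∑ i ∈ S, c i • MvPolynomial.X i) = 0)
    (hS : S.card = m + 2) (i j : VolIdx n m) (hi : i ∈ S) (hj : j ∈ S) (hij : j ≠ i) :
    (vset i ∩ vset j).card = m := by
  obtain ⟨g, hg, hg1, hg2, hg3⟩ := neighbors_surj id Function.injective_id S c hc h hS i hi
  obtain ⟨k, rfl⟩ := hg2 j hj hij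
  apply le_antisymm
  · by_contra hlt
    push Not at hlt
    have e1 : vset i ∩ vset (g k) = vset i :=
      Finset.eq_of_subset_of_card_le Finset.inter_subset_left (by rw [vset_card]; omega)
    have e2 : vset i ∩ vset (g k) = vset (g k) :=
      Finset.eq_of_subset_of_card_le Finset.inter_subset_right (by rw [vset_card]; omega)
    exact hij (vset_inj (e2.symm.trans e1))
  · have : ((vset i).erase (i.1 k)).card = m := by
      rw [Finset.card_erase_of_mem (mem_vset i k), vset_card]; rfl
    refine this.symm.le.trans ?_
    exact Finset.card_le_card (Finset.subset_inter (Finset.erase_subset _ _) (hg3 k))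

theorem exists_T {K : Type*} [Field K] {n m : ℕ}
    [DecidableEq (VolIdx n m)]
    (S : Finset (VolIdx n m)) (c : VolIdx n m → K) (hc : ∀ i ∈ S, c i ≠ 0)
    (h : volMap K n m (∑ i ∈ S, c i • MvPolynomial.X i) = 0)
    (hS : S.card = m + 2) :
    ∃ T : Finset (Fin n), T.card = m + 2 ∧ ∀ i ∈ S, vset i ⊆ T := by
  have hne : S.Nonempty := Finset.card_pos.1 (by omega)
  obtain ⟨i, hi⟩ := hne
  obtain ⟨g, hg, hg1, hg2, hg3⟩ := neighbors_surj id Function.injective_id S c hc h hS i hi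
  simp only [id] at hg3
  have hg0 := Finset.mem_erase.1 (hg1 0)
  have hI := inter_card S c hc h hS
  have hcard : (vset i ∪ vset (g 0)).card = m + 2 := by
    have := Finset.card_union_add_card_inter (vset i) (vset (g 0))
    rw [hI i (g 0) hi hg0.2 hg0.1, vset_card, vset_card] at this
    omega
  refine ⟨vset i ∪ vset (g 0), hcard, ?_⟩
  intro r hr w hw
  by_cases hri : r = i
  · subst hri; exact Finset.mem_union_left _ hw
  obtain ⟨k, rfl⟩ := hg2 r hr hri
  by_cases hk : k = 0
  · subst hk; exact Finset.mem_union_right _ hw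
  by_contra hwT
  rw [Finset.mem_union, not_or] at hwT
  have hrr : ((vset (g k)).erase w).card = m := by
    rw [Finset.card_erase_of_mem hw, vset_card]; rfl
  have e : ∀ j ∈ S, g k ≠ j → w ∉ vset j → (vset (g k)).erase w ⊆ vset j := by
    intro j hj hne hwj
    have : vset j ∩ vset (g k) = (vset (g k)).erase w := by
      apply Finset.eq_of_subset_of_card_le
      · intro v hv
        rw [Finset.mem_inter] at hv
        exact Finset.mem_erase.2 ⟨fun e => hwj (e ▸ hv.1), hv.2⟩
      · rw [hrr, hI j (g k) hj hr hne]
    rw [← this]; exact Finset.inter_subset_left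
  have hb : i.1 0 ∈ vset (g k) := by
    apply hg3 k
    refine Finset.mem_erase.2 ⟨fun e => hk (i.2.injective e).symm, mem_vset i 0⟩
  have hb2 : i.1 0 ∈ vset (g 0) := by
    apply e (g 0) hg0.2 (fun e => hk (hg e)) hwT.2
    exact Finset.mem_erase.2 ⟨fun e => hwT.1 (e ▸ mem_vset i 0), hb⟩
  have : vset i ⊆ vset (g 0) := by
    intro v hv
    by_cases hv0 : v = i.1 0
    · rw [hv0]; exact hb2
    · exact hg3 0 (Finset.mem_erase.2 ⟨hv0, hv⟩)
  exact hg0.1 (vset_inj (Finset.eq_of_subset_of_card_le this (by rw [vset_card, vset_card]))).symm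

/-- faces of a big simplex -/
def faceIdx {n m : ℕ} (t : Fin (m + 2) → Fin n) (ht : StrictMono t) (k : Fin (m + 2)) :
    VolIdx n m :=
  ⟨fun l' => t (k.succAbove l'), ht.comp (Fin.strictMono_succAbove k)⟩

theorem vset_face {n m : ℕ} (t : Fin (m + 2) → Fin n) (ht : StrictMono t) (k : Fin (m + 2)) :
    vset (faceIdx t ht k) = (Finset.univ.image t).erase (t k) := by
  ext v
  simp only [vset, faceIdx, Finset.mem_image, Finset.mem_univ, true_and, Finset.mem_erase]
  constructor
  · rintro ⟨a, rfl⟩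
    exact ⟨fun e => Fin.succAbove_ne k a (ht.injective e), _, rfl⟩
  · rintro ⟨h1, a, rfl⟩
    obtain ⟨b, rfl⟩ := Fin.exists_succAbove_eq (x := a) (y := k) (fun e => h1 (by rw [e]))
    exact ⟨b, rfl⟩

theorem face_inj {n m : ℕ} (t : Fin (m + 2) → Fin n) (ht : StrictMono t) :
    Function.Injective (faceIdx (m := m) t ht) := by
  intro a b hab
  have h := congrArg vset hab
  rw [vset_face, vset_face] at h
  by_contra hne
  have : t a ∈ (Finset.univ.image t).erase (t b) :=
    Finset.mem_erase.2 ⟨fun e => hne (ht.injective e), by simp⟩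
  rw [← h] at this
  simp at this

theorem face_surj {n m : ℕ} (t : Fin (m + 2) → Fin n) (ht : StrictMono t) (s : VolIdx n m)
    (hs : vset s ⊆ Finset.univ.image t) : ∃ k, faceIdx t ht k = s := by
  have hT : (Finset.univ.image t).card = m + 2 := by
    rw [Finset.card_image_of_injective _ ht.injective]; simp
  obtain ⟨v, hv, hvs⟩ := Finset.exists_mem_notMem_of_card_lt_card
    (s := vset s) (t := Finset.univ.image t) (by rw [vset_card, hT]; omega)
  obtain ⟨k, -, rfl⟩ := Finset.mem_image.1 hv
  refine ⟨k, vset_inj ?_⟩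
  rw [vset_face]
  symm
  apply Finset.eq_of_subset_of_card_le
  · intro w hw
    exact Finset.mem_erase.2 ⟨fun e => hvs (e ▸ hw), hs hw⟩
  · rw [Finset.card_erase_of_mem hv, hT, vset_card]; rfl

theorem face_boundary {K : Type*} [Field K] {n m : ℕ} (t : Fin (m + 2) → Fin n)
    (ht : StrictMono t) :
    volMap K n m (∑ k : Fin (m + 2), (-1 : K) ^ (k : ℕ) •
      MvPolynomial.X (faceIdx t ht k)) = 0 := by
  rw [map_sum]
  rw [← vol_boundary (fun i k => (MvPolynomial.X (t i, k) : MvPolynomial (Fin n × Fin m) K))]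
  apply Finset.sum_congr rfl
  intro k _
  rw [map_smul, volMap_X, MvPolynomial.smul_eq_C_mul]
  simp [myVol, faceIdx]

theorem stmt17 {K : Type*} [Field K] {m n : ℕ} (hm : 1 ≤ m) (hmn : m < n)
    (I : Ideal (MvPolynomial (VolIdx n m) K))
    (hI : I = RingHom.ker (volMap K n m).toRingHom)
    (l : MvPolynomial (VolIdx n m) K) (hl0 : l ≠ 0) (hlI : l ∈ I)
    (hcomb : ∃ (s : Finset (VolIdx n m)) (c : VolIdx n m → K),
      s.card ≤ m + 2 ∧ (∀ x ∈ s, c x = 1 ∨ c x = -1) ∧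
      l = ∑ x ∈ s, c x • MvPolynomial.X x) :
    ∃ (t : Fin (m + 2) → Fin n) (ht : StrictMono t),
      l = ∑ k : Fin (m + 2), (-1 : K) ^ (k : ℕ) •
            MvPolynomial.X (⟨fun l' => t (k.succAbove l'),
              ht.comp (Fin.strictMono_succAbove k)⟩ : VolIdx n m) ∨
      l = -∑ k : Fin (m + 2), (-1 : K) ^ (k : ℕ) •
            MvPolynomial.X (⟨fun l' => t (k.succAbove l'),
              ht.comp (Fin.strictMono_succAbove k)⟩ : VolIdx n m) := by
  classical
  obtain ⟨S, c, hcard, hc, hl⟩ := hcomb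
  have hker : volMap K n m (∑ x ∈ S, c x • MvPolynomial.X x) = 0 := by
    rw [hI, RingHom.mem_ker, hl] at hlI
    exact hlI
  have hc0 : ∀ x ∈ S, c x ≠ 0 := by
    intro x hx
    rcases hc x hx with h | h <;> rw [h] <;> simp
  have hne : S.Nonempty := by
    rw [Finset.nonempty_iff_ne_empty]
    rintro rfl
    simp at hl
    exact hl0 hl
  have hS : S.card = m + 2 :=
    le_antisymm hcard (lower_bound id Function.injective_id S c hc0 hker hne)
  obtain ⟨T, hT, hST⟩ := exists_T S c hc0 hker hS
  have ht : StrictMono (T.orderEmbOfFin hT) := (T.orderEmbOfFin hT).strictMono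
  generalize htt : (T.orderEmbOfFin hT : Fin (m + 2) → Fin n) = t at ht
  have himg : Finset.univ.image t = T := by
    rw [← htt]; simp
  have hSim : S = Finset.univ.image (faceIdx t ht) := by
    apply Finset.eq_of_subset_of_card_le
    · intro s hs
      obtain ⟨k, hk⟩ := face_surj t ht s (by rw [himg]; exact hST s hs)
      exact Finset.mem_image.2 ⟨k, Finset.mem_univ _, hk⟩
    · rw [Finset.card_image_of_injective _ (face_inj t ht), hS]; simp
  have hsum : ∑ x ∈ S, c x • (MvPolynomial.X x : MvPolynomial (VolIdx n m) K) =
      ∑ k, c (faceIdx t ht k) • MvPolynomial.X (faceIdx t ht k) := by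
    rw [hSim, Finset.sum_image (fun a _ b _ h => face_inj t ht h)]
  rw [hsum] at hker hl
  set a : Fin (m + 2) → K := fun k => c (faceIdx t ht k) with ha
  set d : Fin (m + 2) → K := fun k => a k - a 0 * (-1) ^ (k : ℕ) with hd
  have hdsum : volMap K n m (∑ k, d k • MvPolynomial.X (faceIdx t ht k)) = 0 := by
    have e : ∑ k, d k • (MvPolynomial.X (faceIdx t ht k) : MvPolynomial (VolIdx n m) K) =
        ∑ k, a k • MvPolynomial.X (faceIdx t ht k) -
        a 0 • ∑ k : Fin (m + 2), (-1 : K) ^ (k : ℕ) • MvPolynomial.X (faceIdx t ht k) := by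
      rw [Finset.smul_sum, ← Finset.sum_sub_distrib]
      apply Finset.sum_congr rfl
      intro k _
      rw [hd, smul_smul, sub_smul]
    rw [e, map_sub, map_smul, face_boundary, hker]
    simp
  have hd0 : ∀ k, d k = 0 := by
    by_contra hcon
    push Not at hcon
    obtain ⟨k, hk⟩ := hcon
    have h1 := lower_bound (faceIdx t ht) (face_inj t ht) (Finset.univ.filter fun k => d k ≠ 0) d
      (by simp) (by
        rw [Finset.sum_filter_of_ne]
        · exact hdsum
        · intro x _ hx h0
          apply hx
          rw [h0, zero_smul]) ⟨k, by simp [hk]⟩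
    have h2 : (Finset.univ.filter fun k => d k ≠ 0) ⊆ Finset.univ.erase 0 := by
      intro x hx
      rw [Finset.mem_filter] at hx
      refine Finset.mem_erase.2 ⟨?_, Finset.mem_univ _⟩
      rintro rfl
      apply hx.2
      simp [hd]
    have h3 := Finset.card_le_card h2
    rw [Finset.card_erase_of_mem (Finset.mem_univ _)] at h3
    simp only [Finset.card_univ, Fintype.card_fin] at h3
    omega
  have hfin : l = a 0 • ∑ k : Fin (m + 2), (-1 : K) ^ (k : ℕ) •
      MvPolynomial.X (faceIdx t ht k) := by
    rw [hl, Finset.smul_sum]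
    apply Finset.sum_congr rfl
    intro k _
    rw [smul_smul, ← sub_eq_zero.1 (hd0 k)]
  refine ⟨t, ht, ?_⟩
  have h0 : faceIdx t ht 0 ∈ S := by rw [hSim]; simp
  rcases hc _ h0 with h | h
  · left
    rw [hfin, show a 0 = 1 from h, one_smul]
    rfl
  · right
    rw [hfin, show a 0 = -1 from h, neg_one_smul]
    rfl
end
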